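/- arXiv:math/0505474 — 2 statements merged into one kernel-verified Lean document; each statement's English description precedes it below -/
import Mathlib

section
/- Let m₁, m₂ be positive integers and set d := gcd(m₁, m₂). Consider the sequence 𝒪(ℂ²) →^{D} 𝒪(ℂ²)/P_{m₁,m₂−1} ⊕ 𝒪(ℂ²)/P_{m₁−1,m₂} →^{E} 𝒪(ℂ²)/P_{2m₁,2m₂}, where D sends u to the pair of classes of −(x₁²·∂₁u + m₁·x₁^{m₁+1}x₂^{m₂}·u) and −(x₂²·∂₂u + m₂·x₁^{m₁}x₂^{m₂+1}·u), and E sends the pair of classes of (g,h) to the class of −x₁²·∂₁h + x₂²·∂₂g + m₂·x₁^{m₁}x₂^{m₂+1}·g − m₁·x₁^{m₁+1}x₂^{m₂}·h. Then: (i) E is well defined on the quotients (the formula maps P_{m₁,m₂−1} ⊕ P_{m₁−1,m₂} into P_{2m₁,2m₂}) and E ∘ D = 0; (ii) dim ker D = d; (iii) dim((ker E)/(im D)) = d; (iv) E is surjective. -/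
/-- First complex partial derivative of a function `ℂ × ℂ → ℂ`. -/
noncomputable def pd1 (f : ℂ × ℂ → ℂ) : ℂ × ℂ → ℂ :=
  fun x => deriv (fun w => f (w, x.2)) x.1

/-- Second complex partial derivative of a function `ℂ × ℂ → ℂ`. -/
noncomputable def pd2 (f : ℂ × ℂ → ℂ) : ℂ × ℂ → ℂ :=
  fun x => deriv (fun w => f (x.1, w)) x.2

/-- The Taylor coefficient `c_{k,l}(f)` of `f : ℂ × ℂ → ℂ` at the origin. -/
noncomputable def taylorCoeff (k l : ℕ) (f : ℂ × ℂ → ℂ) : ℂ :=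
  iteratedDeriv k (fun w => iteratedDeriv l (fun v => f (w, v)) 0) 0 /
    ((Nat.factorial k : ℂ) * (Nat.factorial l : ℂ))

/-- `P_{M,N}`: entire functions on `ℂ²` whose Taylor coefficients `c_{k,l}` vanish
for all `k > M`, `l > N`. -/
def Pset (M N : ℕ) : Set (ℂ × ℂ → ℂ) :=
  {f | Differentiable ℂ f ∧ ∀ k l : ℕ, M < k → N < l → taylorCoeff k l f = 0}

/-- First component of `D u = −(x₁²∂₁u + m₁x₁^{m₁+1}x₂^{m₂}u , x₂²∂₂u + m₂x₁^{m₁}x₂^{m₂+1}u)`. -/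
noncomputable def Dop1 (m₁ m₂ : ℕ) (u : ℂ × ℂ → ℂ) : ℂ × ℂ → ℂ :=
  fun x => -(x.1 ^ 2 * pd1 u x + (m₁ : ℂ) * x.1 ^ (m₁ + 1) * x.2 ^ m₂ * u x)

/-- Second component of `D`. -/
noncomputable def Dop2 (m₁ m₂ : ℕ) (u : ℂ × ℂ → ℂ) : ℂ × ℂ → ℂ :=
  fun x => -(x.2 ^ 2 * pd2 u x + (m₂ : ℂ) * x.1 ^ m₁ * x.2 ^ (m₂ + 1) * u x)

/-- `E(g,h) = −x₁²∂₁h + x₂²∂₂g + m₂x₁^{m₁}x₂^{m₂+1}g − m₁x₁^{m₁+1}x₂^{m₂}h`. -/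
noncomputable def Eop (m₁ m₂ : ℕ) (g h : ℂ × ℂ → ℂ) : ℂ × ℂ → ℂ :=
  fun x => -x.1 ^ 2 * pd1 h x + x.2 ^ 2 * pd2 g x
    + (m₂ : ℂ) * x.1 ^ m₁ * x.2 ^ (m₂ + 1) * g x
    - (m₁ : ℂ) * x.1 ^ (m₁ + 1) * x.2 ^ m₂ * h x

/-- An array of complex numbers is rapidly decreasing if it decays faster than every geometric
sequence; these are the coefficient arrays of the entire functions on `ℂ²`. -/
def RapidDecay (a : ℕ → ℕ → ℂ) : Prop :=
  ∀ R : ℝ, 1 ≤ R → ∃ C : ℝ, ∀ k l, ‖a k l‖ * R ^ (k + l) ≤ C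

/-- `f` is the sum of the everywhere convergent power series with rapidly decreasing
coefficients `a`. -/
def HasTaylorArray (f : ℂ × ℂ → ℂ) (a : ℕ → ℕ → ℂ) : Prop :=
  RapidDecay a ∧ ∀ x : ℂ × ℂ,
    HasSum (fun p : ℕ × ℕ => a p.1 p.2 * x.1 ^ p.1 * x.2 ^ p.2) (f x)

namespace RapidDecay

variable {a b : ℕ → ℕ → ℂ}

lemma of_norm_le (ha : RapidDecay a) (K : ℝ)
    (h : ∀ k l, ‖b k l‖ ≤ K * ((k + l + 1 : ℕ) : ℝ) * ‖a k l‖) : RapidDecay b := by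
  intro R hR
  obtain ⟨C, hC⟩ := ha (2 * R) (by linarith)
  refine ⟨|K| * C, fun k l => ?_⟩
  have h2 : ((k + l + 1 : ℕ) : ℝ) ≤ 2 ^ (k + l) := by
    exact_mod_cast Nat.lt_two_pow_self (n := k + l)
  have hRp : 0 ≤ R ^ (k + l) := by positivity
  calc ‖b k l‖ * R ^ (k + l) ≤ (|K| * 2 ^ (k + l) * ‖a k l‖) * R ^ (k + l) := by
        refine mul_le_mul_of_nonneg_right ((h k l).trans ?_) hRp
        gcongr
        exact le_abs_self K
    _ = |K| * (‖a k l‖ * (2 * R) ^ (k + l)) := by rw [mul_pow]; ring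
    _ ≤ |K| * C := by gcongr; exact hC k l

lemma add (ha : RapidDecay a) (hb : RapidDecay b) : RapidDecay fun k l => a k l + b k l := by
  intro R hR
  obtain ⟨C, hC⟩ := ha R hR
  obtain ⟨C', hC'⟩ := hb R hR
  refine ⟨C + C', fun k l => ?_⟩
  have hRp : 0 ≤ R ^ (k + l) := by positivity
  nlinarith [hC k l, hC' k l, mul_le_mul_of_nonneg_right (norm_add_le (a k l) (b k l)) hRp]

lemma const_mul (ha : RapidDecay a) (c : ℂ) : RapidDecay fun k l => c * a k l := by
  refine ha.of_norm_le ‖c‖ fun k l => ?_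
  rw [norm_mul, mul_assoc]
  gcongr
  refine le_mul_of_one_le_left (norm_nonneg _) ?_
  exact_mod_cast Nat.succ_pos _

lemma sub (ha : RapidDecay a) (hb : RapidDecay b) : RapidDecay fun k l => a k l - b k l := by
  simpa [sub_eq_add_neg] using ha.add (hb.const_mul (-1))

/-- Multiplication by an affine function of the indices preserves rapid decay. -/
lemma affine_mul (ha : RapidDecay a) (p q r : ℕ) :
    RapidDecay fun k l => ((p + q * k + r * l : ℕ) : ℂ) * a k l := by
  refine ha.of_norm_le (p + q + r) fun k l => ?_
  rw [norm_mul, Complex.norm_natCast]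
  gcongr
  push_cast
  have hp : (0 : ℝ) ≤ p := p.cast_nonneg
  have hq : (0 : ℝ) ≤ q := q.cast_nonneg
  have hr : (0 : ℝ) ≤ r := r.cast_nonneg
  have hk : (0 : ℝ) ≤ k := k.cast_nonneg
  have hl : (0 : ℝ) ≤ l := l.cast_nonneg
  nlinarith [mul_nonneg hp hk, mul_nonneg hp hl, mul_nonneg hq hl, mul_nonneg hr hk]

lemma of_norm_le_norm (ha : RapidDecay a) (h : ∀ k l, ‖b k l‖ ≤ ‖a k l‖) : RapidDecay b := by
  intro R hR
  obtain ⟨C, hC⟩ := ha R hR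
  exact ⟨C, fun k l => (mul_le_mul_of_nonneg_right (h k l) (by positivity)).trans (hC k l)⟩

/-- Deleting the first `p` rows and the first `q` columns preserves rapid decay. -/
lemma comp_add (ha : RapidDecay a) (p q : ℕ) : RapidDecay fun k l => a (k + p) (l + q) := by
  intro R hR
  obtain ⟨C, hC⟩ := ha R hR
  refine ⟨C, fun k l => le_trans ?_ (hC (k + p) (l + q))⟩
  gcongr <;> first | exact hR | omega

/-- Prepending `p` zero rows and `q` zero columns preserves rapid decay. -/
lemma shift (ha : RapidDecay a) (p q : ℕ) :
    RapidDecay fun k l => if p ≤ k ∧ q ≤ l then a (k - p) (l - q) else 0 := by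
  intro R hR
  obtain ⟨C, hC⟩ := ha R hR
  have hC0 : 0 ≤ C := le_trans (by positivity) (hC 0 0)
  refine ⟨C * R ^ (p + q), fun k l => ?_⟩
  dsimp only
  split_ifs with h
  · obtain ⟨⟨k, rfl⟩, ⟨l, rfl⟩⟩ := And.intro (Nat.exists_eq_add_of_le h.1)
      (Nat.exists_eq_add_of_le h.2)
    rw [Nat.add_sub_cancel_left, Nat.add_sub_cancel_left,
      show p + k + (q + l) = (k + l) + (p + q) by ring, pow_add, ← mul_assoc]
    gcongr
    exact hC k l
  · simp only [norm_zero, zero_mul]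
    positivity

lemma indicator (ha : RapidDecay a) (s : ℕ → ℕ → Prop) [∀ k l, Decidable (s k l)] :
    RapidDecay fun k l => if s k l then a k l else 0 :=
  ha.of_norm_le_norm fun k l => by split_ifs <;> simp

/-- Absolute convergence of the power series on polydiscs. -/
lemma summable (ha : RapidDecay a) (R : ℝ) (hR : 0 ≤ R) :
    Summable fun p : ℕ × ℕ => ‖a p.1 p.2‖ * R ^ p.1 * R ^ p.2 := by
  obtain ⟨C, hC⟩ := ha (2 * (R + 1)) (by linarith)
  have hg : Summable fun n : ℕ => ((1 / 2 : ℝ)) ^ n :=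
    summable_geometric_of_lt_one (by norm_num) (by norm_num)
  have hgg := (hg.mul_of_nonneg hg (fun _ => by positivity) (fun _ => by positivity)).mul_left C
  refine Summable.of_nonneg_of_le (fun p => by positivity) (fun p => ?_) hgg
  have h1 : ‖a p.1 p.2‖ * R ^ p.1 * R ^ p.2 ≤ ‖a p.1 p.2‖ * (R + 1) ^ (p.1 + p.2) := by
    rw [mul_assoc, ← pow_add]
    gcongr
    linarith
  refine h1.trans ?_
  have h2 := hC p.1 p.2
  rw [mul_pow] at h2
  have h3 : (0 : ℝ) < 2 ^ (p.1 + p.2) := by positivity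
  rw [← pow_add, one_div, inv_pow, ← div_eq_mul_inv, le_div_iff₀ h3]
  linarith

end RapidDecay

namespace HasTaylorArray

variable {f g : ℂ × ℂ → ℂ} {a b : ℕ → ℕ → ℂ}

lemma add (hf : HasTaylorArray f a) (hg : HasTaylorArray g b) :
    HasTaylorArray (f + g) (fun k l => a k l + b k l) :=
  ⟨hf.1.add hg.1, fun x => by
    simpa only [add_mul, Pi.add_apply] using (hf.2 x).add (hg.2 x)⟩

lemma const_mul (hf : HasTaylorArray f a) (c : ℂ) :
    HasTaylorArray (fun x => c * f x) (fun k l => c * a k l) :=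
  ⟨hf.1.const_mul c, fun x => by simpa only [mul_assoc] using (hf.2 x).mul_left c⟩

lemma monomial_mul (hf : HasTaylorArray f a) (p q : ℕ) :
    HasTaylorArray (fun x => x.1 ^ p * x.2 ^ q * f x)
      (fun k l => if p ≤ k ∧ q ≤ l then a (k - p) (l - q) else 0) := by
  refine ⟨hf.1.shift p q, fun x => ?_⟩
  have hinj : Function.Injective fun r : ℕ × ℕ => (r.1 + p, r.2 + q) := fun r s h => by
    simp only [Prod.mk.injEq, Nat.add_right_cancel_iff] at h
    exact Prod.ext h.1 h.2
  refine (hinj.hasSum_iff ?_).1 ?_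
  · rintro ⟨k, l⟩ h
    have : ¬ (p ≤ k ∧ q ≤ l) := fun hkl =>
      h ⟨(k - p, l - q), by simp [Nat.sub_add_cancel hkl.1, Nat.sub_add_cancel hkl.2]⟩
    simp [this]
  · refine ((hf.2 x).mul_left (x.1 ^ p * x.2 ^ q)).congr_fun ?_
    rintro ⟨k, l⟩
    simp [pow_add]
    ring

lemma pd1 (hf : HasTaylorArray f a) :
    HasTaylorArray (pd1 f) (fun k l => ((k + 1 : ℕ) : ℂ) * a (k + 1) l) := by
  refine ⟨?_, fun x => ?_⟩
  · simpa [add_comm] using (hf.1.comp_add 1 0).affine_mul 1 1 0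
  · set R : ℝ := ‖x.1‖ + ‖x.2‖ + 1 with hR
    have hsum := hf.1.summable R (by positivity)
    have key := Complex.hasSum_deriv_of_summable_norm (z := x.1) hsum
      (F := fun (p : ℕ × ℕ) w => a p.1 p.2 * w ^ p.1 * x.2 ^ p.2) (U := Metric.ball 0 R)
      (fun i => by fun_prop) Metric.isOpen_ball (fun i w hw => by
        rw [norm_mul, norm_mul, norm_pow, norm_pow]
        have hw' : ‖w‖ ≤ R := by simpa using (Metric.mem_ball.1 hw).le
        have hx' : ‖x.2‖ ≤ R := by rw [hR]; linarith [norm_nonneg x.1]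
        gcongr) (by rw [mem_ball_zero_iff, hR]; linarith [norm_nonneg x.2])
    have hfun : (fun w => ∑' p : ℕ × ℕ, a p.1 p.2 * w ^ p.1 * x.2 ^ p.2) =
        fun w => f (w, x.2) := funext fun w => (hf.2 (w, x.2)).tsum_eq
    rw [hfun] at key
    have hinj : Function.Injective fun r : ℕ × ℕ => (r.1 + 1, r.2) := fun r s h => by
      simp only [Prod.mk.injEq, Nat.add_right_cancel_iff] at h
      exact Prod.ext h.1 h.2
    refine ((hinj.hasSum_iff ?_).2 key).congr_fun ?_
    · rintro ⟨k, l⟩ h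
      rcases k with _ | k
      · simp
      · exact (h ⟨(k, l), rfl⟩).elim
    · rintro ⟨k, l⟩
      simp only [Function.comp_apply, deriv_mul_const_field', deriv_const_mul_field',
        deriv_pow_field, Nat.add_sub_cancel]
      ring

lemma swap (hf : HasTaylorArray f a) :
    HasTaylorArray (fun x => f x.swap) (fun k l => a l k) := by
  refine ⟨fun R hR => ?_, fun x => ?_⟩
  · obtain ⟨C, hC⟩ := hf.1 R hR
    exact ⟨C, fun k l => by simpa [add_comm] using hC l k⟩
  · refine ((Equiv.prodComm ℕ ℕ).hasSum_iff.2 (hf.2 x.swap)).congr_fun ?_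
    rintro ⟨k, l⟩
    simp
    ring

lemma pd2 (hf : HasTaylorArray f a) :
    HasTaylorArray (pd2 f) (fun k l => ((l + 1 : ℕ) : ℂ) * a k (l + 1)) :=
  hf.swap.pd1.swap

lemma apply_zero (hf : HasTaylorArray f a) : f (0, 0) = a 0 0 := by
  refine (hf.2 (0, 0)).unique ?_
  convert hasSum_single ((0, 0) : ℕ × ℕ) ?_ using 1
  · simp
  · rintro ⟨k, l⟩ h
    rcases k with _ | k <;> rcases l with _ | l <;> simp_all

lemma iterate_pd1 (hf : HasTaylorArray f a) (n : ℕ) :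
    HasTaylorArray (_root_.pd1^[n] f) (fun k l => ((k + 1).ascFactorial n : ℂ) * a (k + n) l) := by
  induction n generalizing f a with
  | zero => simpa using hf
  | succ n ih =>
    refine (congrArg (HasTaylorArray _) (funext₂ fun k l => ?_)).mpr (ih hf.pd1)
    rw [Nat.ascFactorial_succ]
    push_cast
    ring_nf

lemma iterate_pd2 (hf : HasTaylorArray f a) (n : ℕ) :
    HasTaylorArray (_root_.pd2^[n] f) (fun k l => ((l + 1).ascFactorial n : ℂ) * a k (l + n)) := by
  induction n generalizing f a with
  | zero => simpa using hf
  | succ n ih =>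
    refine (congrArg (HasTaylorArray _) (funext₂ fun k l => ?_)).mpr (ih hf.pd2)
    rw [Nat.ascFactorial_succ]
    push_cast
    ring_nf

end HasTaylorArray

lemma iterate_pd1_apply (n : ℕ) (f : ℂ × ℂ → ℂ) (x : ℂ × ℂ) :
    pd1^[n] f x = iteratedDeriv n (fun w => f (w, x.2)) x.1 := by
  induction n generalizing f x with
  | zero => simp
  | succ n ih => rw [Function.iterate_succ_apply, ih, iteratedDeriv_succ']; rfl

lemma iterate_pd2_apply (n : ℕ) (f : ℂ × ℂ → ℂ) (x : ℂ × ℂ) :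
    pd2^[n] f x = iteratedDeriv n (fun w => f (x.1, w)) x.2 := by
  induction n generalizing f x with
  | zero => simp
  | succ n ih => rw [Function.iterate_succ_apply, ih, iteratedDeriv_succ']; rfl

lemma taylorCoeff_eq_iterate_pd (k l : ℕ) (f : ℂ × ℂ → ℂ) :
    taylorCoeff k l f = pd1^[k] (pd2^[l] f) (0, 0) / ((k.factorial : ℂ) * l.factorial) := by
  simp only [taylorCoeff, iterate_pd1_apply, iterate_pd2_apply]

namespace HasTaylorArray

variable {f g : ℂ × ℂ → ℂ} {a b : ℕ → ℕ → ℂ}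

lemma taylorCoeff_eq (hf : HasTaylorArray f a) (k l : ℕ) : taylorCoeff k l f = a k l := by
  rw [taylorCoeff_eq_iterate_pd, ((hf.iterate_pd2 l).iterate_pd1 k).apply_zero]
  have hk : (k.factorial : ℂ) ≠ 0 := by exact_mod_cast k.factorial_ne_zero
  have hl : (l.factorial : ℂ) ≠ 0 := by exact_mod_cast l.factorial_ne_zero
  simp only [zero_add, Nat.one_ascFactorial]
  field_simp

lemma differentiable (hf : HasTaylorArray f a) : Differentiable ℂ f := by
  intro x
  set R : ℝ := ‖x‖ + 1 with hR
  have hR1 : 1 ≤ R := by rw [hR]; linarith [norm_nonneg x]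
  have hsum := (hf.1.affine_mul 0 1 1).summable R (by positivity)
  have hfun : f = fun y => ∑' p : ℕ × ℕ, a p.1 p.2 * y.1 ^ p.1 * y.2 ^ p.2 :=
    funext fun y => (hf.2 y).tsum_eq.symm
  have hder : ∀ (p : ℕ × ℕ) (y : ℂ × ℂ), HasFDerivAt
      (fun y : ℂ × ℂ => a p.1 p.2 * y.1 ^ p.1 * y.2 ^ p.2)
      ((a p.1 p.2 * p.1 * y.1 ^ (p.1 - 1) * y.2 ^ p.2) • ContinuousLinearMap.fst ℂ ℂ ℂ +
        (a p.1 p.2 * y.1 ^ p.1 * (p.2 * y.2 ^ (p.2 - 1))) • ContinuousLinearMap.snd ℂ ℂ ℂ) y := by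
    intro p y
    have h1 := ((hasFDerivAt_fst (𝕜 := ℂ) (p := y)).pow p.1).const_mul (a p.1 p.2)
    have h2 := (hasFDerivAt_snd (𝕜 := ℂ) (p := y)).pow p.2
    refine (h1.mul h2).congr_fderiv ?_
    ext
    · simp
      ring
    · simp
  rw [hfun]
  refine (hasFDerivAt_tsum_of_isPreconnected hsum (s := Metric.ball 0 R) Metric.isOpen_ball
    (convex_ball _ _).isPreconnected (fun p y _ => hder p y) (fun p y hy => ?_) (x₀ := x) ?_
    (hf.2 x).summable ?_).differentiableAt
  · have hyR : ‖y‖ ≤ R := by simpa using (Metric.mem_ball.1 hy).le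
    have hy1 : ‖y.1‖ ≤ R := (norm_fst_le y).trans hyR
    have hy2 : ‖y.2‖ ≤ R := (norm_snd_le y).trans hyR
    refine (norm_add_le _ _).trans ?_
    rw [norm_smul, norm_smul]
    have e1 : ‖a p.1 p.2 * p.1 * y.1 ^ (p.1 - 1) * y.2 ^ p.2‖ ≤
        ‖a p.1 p.2‖ * p.1 * R ^ p.1 * R ^ p.2 := by
      simp only [norm_mul, norm_pow, Complex.norm_natCast]
      gcongr
      exact (pow_le_pow_left₀ (norm_nonneg _) hy1 _).trans (pow_le_pow_right₀ hR1 (by omega))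
    have e2 : ‖a p.1 p.2 * y.1 ^ p.1 * (p.2 * y.2 ^ (p.2 - 1))‖ ≤
        ‖a p.1 p.2‖ * R ^ p.1 * (p.2 * R ^ p.2) := by
      simp only [norm_mul, norm_pow, Complex.norm_natCast]
      gcongr
      exact (pow_le_pow_left₀ (norm_nonneg _) hy2 _).trans (pow_le_pow_right₀ hR1 (by omega))
    have f1 := ContinuousLinearMap.norm_fst_le ℂ ℂ ℂ
    have f2 := ContinuousLinearMap.norm_snd_le ℂ ℂ ℂ
    calc _ ≤ (‖a p.1 p.2‖ * p.1 * R ^ p.1 * R ^ p.2) * 1 +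
          (‖a p.1 p.2‖ * R ^ p.1 * (p.2 * R ^ p.2)) * 1 := by gcongr
      _ = _ := by rw [norm_mul, Complex.norm_natCast]; push_cast; ring
  · simp [hR]
  · simp [hR]

end HasTaylorArray

lemma RapidDecay.exists_hasTaylorArray {a : ℕ → ℕ → ℂ} (ha : RapidDecay a) :
    ∃ f, HasTaylorArray f a := by
  refine ⟨fun x => ∑' p : ℕ × ℕ, a p.1 p.2 * x.1 ^ p.1 * x.2 ^ p.2, ha, fun x => ?_⟩
  refine Summable.hasSum (Summable.of_norm_bounded (ha.summable ‖x‖ (norm_nonneg x)) fun p => ?_)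
  rw [norm_mul, norm_mul, norm_pow, norm_pow]
  have := norm_fst_le x
  have := norm_snd_le x
  gcongr

/-- Holomorphic dependence of an integral on a parameter. -/
lemma differentiable_integral_mul_comp {f : ℂ × ℂ → ℂ} (hf : Differentiable ℂ f) {φ γ : ℝ → ℂ}
    (hφ : Continuous φ) (hγ : Continuous γ) (s t : ℝ) :
    Differentiable ℂ fun w => ∫ θ in s..t, φ θ * f (w, γ θ) := by
  intro w₀
  have hfc := hf.continuous
  obtain ⟨M, hM⟩ := ((isCompact_closedBall w₀ 2).prod
    ((isCompact_uIcc (a := s) (b := t)).image hγ)).exists_bound_of_continuousOn hfc.continuousOn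
  have hd : ∀ v, Differentiable ℂ fun w => f (w, v) := fun v => by fun_prop
  have hmeas : Measurable fun θ => pd1 f (w₀, γ θ) := by
    have h := measurable_deriv_with_param (𝕜 := ℂ) (f := fun v w : ℂ => f (w, v))
      (hfc.comp continuous_swap)
    exact h.comp (hγ.measurable.prodMk measurable_const)
  refine (intervalIntegral.hasDerivAt_integral_of_dominated_loc_of_deriv_le
    (F' := fun w θ => φ θ * pd1 f (w, γ θ)) (bound := fun θ => ‖φ θ‖ * M)
    (Metric.ball_mem_nhds w₀ one_pos) ?_ ?_ ?_ ?_ ?_ ?_).2.differentiableAt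
  · exact Filter.Eventually.of_forall fun w =>
      (show Continuous fun θ => φ θ * f (w, γ θ) by fun_prop).aestronglyMeasurable
  · exact (show Continuous fun θ => φ θ * f (w₀, γ θ) by fun_prop).intervalIntegrable _ _
  · exact (hφ.measurable.mul hmeas).aestronglyMeasurable
  · refine Filter.Eventually.of_forall fun θ hθ w hw => ?_
    rw [norm_mul]
    refine mul_le_mul_of_nonneg_left ?_ (norm_nonneg _)
    have := Complex.norm_deriv_le_of_forall_mem_sphere_norm_le (c := w) one_pos
      (hd (γ θ)).diffContOnCl (C := M) fun z hz => hM (z, γ θ) ⟨?_, ?_⟩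
    · rwa [div_one] at this
    · rw [Metric.mem_closedBall]
      have h1 := Metric.mem_ball.1 hw
      have h2 := Metric.mem_sphere.1 hz
      linarith [dist_triangle z w w₀]
    · exact ⟨θ, Set.uIoc_subset_uIcc hθ, rfl⟩
  · exact (show Continuous fun θ => ‖φ θ‖ * M by fun_prop).intervalIntegrable _ _
  · exact Filter.Eventually.of_forall fun θ _ w _ => ((hd (γ θ)) w).hasDerivAt.const_mul _

lemma differentiable_iteratedDeriv_snd {f : ℂ × ℂ → ℂ} (hf : Differentiable ℂ f) (l : ℕ) :
    Differentiable ℂ fun w => iteratedDeriv l (fun v => f (w, v)) 0 := by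
  have hcauchy : ∀ w, iteratedDeriv l (fun v => f (w, v)) 0 =
      (2 * Real.pi * Complex.I / l.factorial)⁻¹ *
        ∫ θ in (0 : ℝ)..2 * Real.pi, (circleMap 0 1 θ * Complex.I *
          (1 / circleMap 0 1 θ ^ (l + 1))) * f (w, circleMap 0 1 θ) := by
    intro w
    have hd : Differentiable ℂ fun v => f (w, v) := by fun_prop
    have h := DiffContOnCl.circleIntegral_one_div_sub_center_pow_smul one_pos l
      (hd.diffContOnCl (s := Metric.ball 0 1))
    have h0 : (2 * Real.pi * Complex.I / l.factorial : ℂ) ≠ 0 := by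
      simp [Nat.factorial_ne_zero, Real.pi_ne_zero]
    rw [eq_inv_mul_iff_mul_eq₀ h0, ← smul_eq_mul, ← h, circleIntegral]
    simp [deriv_circleMap, mul_assoc]
  simp_rw [hcauchy]
  refine (differentiable_integral_mul_comp hf ?_ (continuous_circleMap 0 1) _ _).const_mul _
  have h1 : ∀ θ, circleMap 0 1 θ ^ (l + 1) ≠ 0 := fun θ =>
    pow_ne_zero _ (circleMap_ne_center one_ne_zero)
  have := continuous_circleMap 0 1
  fun_prop (disch := exact h1 _)

lemma rapidDecay_taylorCoeff {f : ℂ × ℂ → ℂ} (hf : Differentiable ℂ f) :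
    RapidDecay fun k l => taylorCoeff k l f := by
  intro R hR
  have hR0 : 0 < R := by linarith
  obtain ⟨M, hM⟩ := ((isCompact_closedBall (0 : ℂ) R).prod
    (isCompact_closedBall (0 : ℂ) R)).exists_bound_of_continuousOn hf.continuous.continuousOn
  refine ⟨M, fun k l => ?_⟩
  have h1 : ∀ w ∈ Metric.sphere (0 : ℂ) R,
      ‖iteratedDeriv l (fun v => f (w, v)) 0‖ ≤ l.factorial * M / R ^ l := fun w hw =>
    Complex.norm_iteratedDeriv_le_of_forall_mem_sphere_norm_le l hR0
      (Differentiable.diffContOnCl (by fun_prop)) fun v hv =>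
      hM (w, v) ⟨Metric.sphere_subset_closedBall hw, Metric.sphere_subset_closedBall hv⟩
  have h2 := Complex.norm_iteratedDeriv_le_of_forall_mem_sphere_norm_le k hR0
    (differentiable_iteratedDeriv_snd hf l).diffContOnCl h1
  have hk : (0 : ℝ) < k.factorial := by exact_mod_cast k.factorial_pos
  have hl : (0 : ℝ) < l.factorial := by exact_mod_cast l.factorial_pos
  simp only [taylorCoeff]
  rw [norm_div, norm_mul, Complex.norm_natCast, Complex.norm_natCast,
    ← le_div_iff₀ (by positivity), div_le_iff₀ (by positivity)]
  refine h2.trans (le_of_eq ?_)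
  rw [pow_add]
  field_simp

lemma hasTaylorArray_taylorCoeff {f : ℂ × ℂ → ℂ} (hf : Differentiable ℂ f) :
    HasTaylorArray f fun k l => taylorCoeff k l f := by
  obtain ⟨g, hg⟩ := (rapidDecay_taylorCoeff hf).exists_hasTaylorArray
  suffices h : f = g by rwa [← h] at hg
  ext x
  have hsum := ((Equiv.prodComm ℕ ℕ).hasSum_iff.2 (hg.2 x))
  have hfib : ∀ l : ℕ, HasSum (fun k => taylorCoeff k l f * x.1 ^ k * x.2 ^ l)
      ((l.factorial : ℂ)⁻¹ * x.2 ^ l * iteratedDeriv l (fun v => f (x.1, v)) 0) := by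
    intro l
    have h := (Complex.hasSum_taylorSeries_of_entire
      (differentiable_iteratedDeriv_snd hf l) 0 x.1).mul_left ((l.factorial : ℂ)⁻¹ * x.2 ^ l)
    refine h.congr_fun fun k => ?_
    simp only [taylorCoeff, smul_eq_mul, sub_zero]
    have hk : (k.factorial : ℂ) ≠ 0 := by exact_mod_cast k.factorial_ne_zero
    have hl : (l.factorial : ℂ) ≠ 0 := by exact_mod_cast l.factorial_ne_zero
    field_simp
  have h1 := hsum.prod_fiberwise hfib
  have h2 := Complex.hasSum_taylorSeries_of_entire (f := fun v => f (x.1, v)) (by fun_prop) 0 x.2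
  refine h2.unique (h1.congr_fun fun l => ?_)
  simp [mul_assoc]

lemma Differentiable.taylorCoeff_add {f g : ℂ × ℂ → ℂ} (hf : Differentiable ℂ f)
    (hg : Differentiable ℂ g) (k l : ℕ) :
    taylorCoeff k l (f + g) = taylorCoeff k l f + taylorCoeff k l g :=
  ((hasTaylorArray_taylorCoeff hf).add (hasTaylorArray_taylorCoeff hg)).taylorCoeff_eq k l

lemma Differentiable.taylorCoeff_smul {f : ℂ × ℂ → ℂ} (hf : Differentiable ℂ f) (c : ℂ)
    (k l : ℕ) : taylorCoeff k l (c • f) = c * taylorCoeff k l f :=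
  ((hasTaylorArray_taylorCoeff hf).const_mul c).taylorCoeff_eq k l

lemma Differentiable.taylorCoeff_sub {f g : ℂ × ℂ → ℂ} (hf : Differentiable ℂ f)
    (hg : Differentiable ℂ g) (k l : ℕ) :
    taylorCoeff k l (f - g) = taylorCoeff k l f - taylorCoeff k l g := by
  have h := hf.taylorCoeff_add (hg.const_smul (-1 : ℂ)) k l
  rw [hg.taylorCoeff_smul] at h
  simpa [sub_eq_add_neg] using h

lemma taylorCoeff_zero (k l : ℕ) : taylorCoeff k l (0 : ℂ × ℂ → ℂ) = 0 := by
  simpa using (differentiable_const (0 : ℂ)).taylorCoeff_smul 0 k l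

/-- An entire function is determined by its Taylor coefficients at the origin. -/
lemma Differentiable.eq_zero_of_taylorCoeff {f : ℂ × ℂ → ℂ} (hf : Differentiable ℂ f)
    (h : ∀ k l, taylorCoeff k l f = 0) : f = 0 := by
  ext x
  refine ((hasTaylorArray_taylorCoeff hf).2 x).unique ?_
  simp [h]

/-- A rapidly decreasing array is the array of Taylor coefficients of an entire function with
respect to the monomials divisible by `x₁^p x₂^q`. -/
lemma RapidDecay.exists_taylorCoeff_add {a : ℕ → ℕ → ℂ} (ha : RapidDecay a) (p q : ℕ) :
    ∃ f, Differentiable ℂ f ∧ ∀ i j, taylorCoeff (p + i) (q + j) f = a i j := by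
  obtain ⟨f, hf⟩ := ha.exists_hasTaylorArray
  have h := hf.monomial_mul p q
  exact ⟨_, h.differentiable, fun i j => by simp [h.taylorCoeff_eq]⟩

lemma rapidDecay_taylorCoeff_add {f : ℂ × ℂ → ℂ} (hf : Differentiable ℂ f) (p q : ℕ) :
    RapidDecay fun i j => taylorCoeff (p + i) (q + j) f := by
  simpa only [add_comm] using (rapidDecay_taylorCoeff hf).comp_add p q

lemma rapidDecay_zero : RapidDecay fun _ _ => 0 := fun _ _ => ⟨0, by simp⟩

section Operators

variable {m₁ m₂ : ℕ} {u g h : ℂ × ℂ → ℂ}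

lemma hasTaylorArray_Dop1 (hu : Differentiable ℂ u) : HasTaylorArray (Dop1 m₁ m₂ u)
    fun k l =>
      -1 * (if 2 ≤ k ∧ 0 ≤ l then ((k - 2 + 1 : ℕ) : ℂ) * taylorCoeff (k - 2 + 1) (l - 0) u else 0) +
      -m₁ * (if m₁ + 1 ≤ k ∧ m₂ ≤ l then taylorCoeff (k - (m₁ + 1)) (l - m₂) u else 0) := by
  have H := hasTaylorArray_taylorCoeff hu
  have h := ((H.pd1.monomial_mul 2 0).const_mul (-1)).add
    ((H.monomial_mul (m₁ + 1) m₂).const_mul (-m₁))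
  have e : Dop1 m₁ m₂ u = (fun x => -1 * (x.1 ^ 2 * x.2 ^ 0 * pd1 u x)) +
      fun x => -m₁ * (x.1 ^ (m₁ + 1) * x.2 ^ m₂ * u x) := by
    ext x
    simp only [Dop1, Pi.add_apply]
    ring
  exact e ▸ h

lemma hasTaylorArray_Dop2 (hu : Differentiable ℂ u) : HasTaylorArray (Dop2 m₁ m₂ u)
    fun k l =>
      -1 * (if 0 ≤ k ∧ 2 ≤ l then ((l - 2 + 1 : ℕ) : ℂ) * taylorCoeff (k - 0) (l - 2 + 1) u else 0) +
      -m₂ * (if m₁ ≤ k ∧ m₂ + 1 ≤ l then taylorCoeff (k - m₁) (l - (m₂ + 1)) u else 0) := by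
  have H := hasTaylorArray_taylorCoeff hu
  have h := ((H.pd2.monomial_mul 0 2).const_mul (-1)).add
    ((H.monomial_mul m₁ (m₂ + 1)).const_mul (-m₂))
  have e : Dop2 m₁ m₂ u = (fun x => -1 * (x.1 ^ 0 * x.2 ^ 2 * pd2 u x)) +
      fun x => -m₂ * (x.1 ^ m₁ * x.2 ^ (m₂ + 1) * u x) := by
    ext x
    simp only [Dop2, Pi.add_apply]
    ring
  exact e ▸ h

lemma hasTaylorArray_Eop (hg : Differentiable ℂ g) (hh : Differentiable ℂ h) :
    HasTaylorArray (Eop m₁ m₂ g h) fun k l =>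
      -1 * (if 2 ≤ k ∧ 0 ≤ l then ((k - 2 + 1 : ℕ) : ℂ) * taylorCoeff (k - 2 + 1) (l - 0) h else 0) +
      (if 0 ≤ k ∧ 2 ≤ l then ((l - 2 + 1 : ℕ) : ℂ) * taylorCoeff (k - 0) (l - 2 + 1) g else 0) +
      (m₂ * (if m₁ ≤ k ∧ m₂ + 1 ≤ l then taylorCoeff (k - m₁) (l - (m₂ + 1)) g else 0) +
      -m₁ * (if m₁ + 1 ≤ k ∧ m₂ ≤ l then taylorCoeff (k - (m₁ + 1)) (l - m₂) h else 0)) := by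
  have G := hasTaylorArray_taylorCoeff hg
  have H := hasTaylorArray_taylorCoeff hh
  have k := (((H.pd1.monomial_mul 2 0).const_mul (-1)).add (G.pd2.monomial_mul 0 2)).add
    (((G.monomial_mul m₁ (m₂ + 1)).const_mul m₂).add
      ((H.monomial_mul (m₁ + 1) m₂).const_mul (-m₁)))
  have e : Eop m₁ m₂ g h = ((fun x => -1 * (x.1 ^ 2 * x.2 ^ 0 * pd1 h x)) +
      fun x => x.1 ^ 0 * x.2 ^ 2 * pd2 g x) +
      ((fun x => m₂ * (x.1 ^ m₁ * x.2 ^ (m₂ + 1) * g x)) +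
        fun x => -m₁ * (x.1 ^ (m₁ + 1) * x.2 ^ m₂ * h x)) := by
    ext x
    simp only [Eop, Pi.add_apply]
    ring
  exact e ▸ k

lemma taylorCoeff_Dop1 (hm₁ : 0 < m₁) (hu : Differentiable ℂ u) (i j : ℕ) :
    taylorCoeff (m₁ + 1 + i) (m₂ + j) (Dop1 m₁ m₂ u) =
      -((m₁ + i) * taylorCoeff (m₁ + i) (m₂ + j) u + m₁ * taylorCoeff i j u) := by
  rw [(hasTaylorArray_Dop1 hu).taylorCoeff_eq, if_pos (by omega), if_pos (by omega),
    show m₁ + 1 + i - 2 + 1 = m₁ + i by omega, show m₁ + 1 + i - (m₁ + 1) = i by omega,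
    Nat.add_sub_cancel_left, Nat.sub_zero]
  push_cast
  ring

lemma taylorCoeff_Dop2 (hm₂ : 0 < m₂) (hu : Differentiable ℂ u) (i j : ℕ) :
    taylorCoeff (m₁ + i) (m₂ + 1 + j) (Dop2 m₁ m₂ u) =
      -((m₂ + j) * taylorCoeff (m₁ + i) (m₂ + j) u + m₂ * taylorCoeff i j u) := by
  rw [(hasTaylorArray_Dop2 hu).taylorCoeff_eq, if_pos (by omega), if_pos (by omega),
    show m₂ + 1 + j - 2 + 1 = m₂ + j by omega, show m₂ + 1 + j - (m₂ + 1) = j by omega,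
    Nat.add_sub_cancel_left, Nat.sub_zero]
  push_cast
  ring

lemma taylorCoeff_Eop (hm₁ : 0 < m₁) (hm₂ : 0 < m₂) (hg : Differentiable ℂ g)
    (hh : Differentiable ℂ h) (i j : ℕ) :
    taylorCoeff (2 * m₁ + 1 + i) (2 * m₂ + 1 + j) (Eop m₁ m₂ g h) =
      (2 * m₂ + j) * taylorCoeff (m₁ + 1 + (m₁ + i)) (m₂ + (m₂ + j)) g
        + m₂ * taylorCoeff (m₁ + 1 + i) (m₂ + j) g
        - (2 * m₁ + i) * taylorCoeff (m₁ + (m₁ + i)) (m₂ + 1 + (m₂ + j)) h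
        - m₁ * taylorCoeff (m₁ + i) (m₂ + 1 + j) h := by
  rw [(hasTaylorArray_Eop hg hh).taylorCoeff_eq, if_pos (by omega), if_pos (by omega),
    if_pos (by omega), if_pos (by omega),
    show 2 * m₁ + 1 + i - 2 + 1 = m₁ + (m₁ + i) by omega,
    show 2 * m₁ + 1 + i - (m₁ + 1) = m₁ + i by omega,
    show 2 * m₁ + 1 + i - m₁ = m₁ + 1 + i by omega,
    show 2 * m₁ + 1 + i - 0 = m₁ + 1 + (m₁ + i) by omega,
    show 2 * m₂ + 1 + j - 2 + 1 = m₂ + (m₂ + j) by omega,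
    show 2 * m₂ + 1 + j - (m₂ + 1) = m₂ + j by omega,
    show 2 * m₂ + 1 + j - m₂ = m₂ + 1 + j by omega,
    show 2 * m₂ + 1 + j - 0 = m₂ + 1 + (m₂ + j) by omega]
  push_cast
  ring

lemma mem_Pset_iff {f : ℂ × ℂ → ℂ} {M N : ℕ} :
    f ∈ Pset M N ↔ Differentiable ℂ f ∧ ∀ i j, taylorCoeff (M + 1 + i) (N + 1 + j) f = 0 := by
  refine and_congr_right fun _ => ⟨fun h i j => h _ _ (by omega) (by omega), fun h k l hk hl => ?_⟩
  obtain ⟨i, rfl⟩ := Nat.exists_eq_add_of_lt hk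
  obtain ⟨j, rfl⟩ := Nat.exists_eq_add_of_lt hl
  simpa only [add_right_comm] using h i j

lemma mem_Pset_sub_one_right {f : ℂ × ℂ → ℂ} (hm₂ : 0 < m₂) : f ∈ Pset m₁ (m₂ - 1) ↔
    Differentiable ℂ f ∧ ∀ i j, taylorCoeff (m₁ + 1 + i) (m₂ + j) f = 0 := by
  rw [mem_Pset_iff, Nat.sub_add_cancel hm₂]

lemma mem_Pset_sub_one_left {f : ℂ × ℂ → ℂ} (hm₁ : 0 < m₁) : f ∈ Pset (m₁ - 1) m₂ ↔
    Differentiable ℂ f ∧ ∀ i j, taylorCoeff (m₁ + i) (m₂ + 1 + j) f = 0 := by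
  rw [mem_Pset_iff, Nat.sub_add_cancel hm₁]

end Operators

section Arrays

/-- The solution `a` of `(N + i) a (m₁ + i) (m₂ + j) + m₁ a i j = e i j` with initial values `b`. -/
noncomputable def chainSolution (m₁ m₂ N : ℕ) (e b : ℕ → ℕ → ℂ) (i j : ℕ) : ℂ :=
  if 0 < m₁ ∧ m₁ ≤ i ∧ m₂ ≤ j then
    (e (i - m₁) (j - m₂) - m₁ * chainSolution m₁ m₂ N e b (i - m₁) (j - m₂)) /
      ((N + (i - m₁) : ℕ) : ℂ)
  else b i j
termination_by i
decreasing_by omega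

variable {m₁ m₂ N : ℕ} {e b : ℕ → ℕ → ℂ}

lemma chainSolution_of_lt {i j : ℕ} (h : i < m₁ ∨ j < m₂) :
    chainSolution m₁ m₂ N e b i j = b i j := by
  rw [chainSolution, if_neg (by omega)]

lemma chainSolution_add (hm₁ : 0 < m₁) (i j : ℕ) :
    chainSolution m₁ m₂ N e b (m₁ + i) (m₂ + j) =
      (e i j - m₁ * chainSolution m₁ m₂ N e b i j) / ((N + i : ℕ) : ℂ) := by
  rw [chainSolution, if_pos (by omega), Nat.add_sub_cancel_left, Nat.add_sub_cancel_left]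

lemma rapidDecay_chainSolution (hm₁ : 0 < m₁) (hN : 0 < N) (he : RapidDecay e)
    (hb : RapidDecay b) : RapidDecay (chainSolution m₁ m₂ N e b) := by
  intro R hR
  obtain ⟨Ce, hCe⟩ := he R hR
  obtain ⟨Cb, hCb⟩ := hb R hR
  set K : ℝ := m₁ * R ^ (m₁ + m₂) with hK
  set B : ℝ := |Ce| * R ^ (m₁ + m₂) + |Cb| with hB
  obtain ⟨T, hT⟩ := exists_nat_ge K
  have hK0 : 0 ≤ K := by positivity
  have hB0 : 0 ≤ B := by positivity
  have hL : 1 ≤ 1 + K := by linarith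
  have key : ∀ i j, ‖chainSolution m₁ m₂ N e b i j‖ * R ^ (i + j) ≤ B * (1 + K) ^ min i T := by
    intro i
    induction i using Nat.strong_induction_on with
    | _ i ih =>
      intro j
      by_cases hij : m₁ ≤ i ∧ m₂ ≤ j
      · obtain ⟨⟨i, rfl⟩, ⟨j, rfl⟩⟩ := And.intro (Nat.exists_eq_add_of_le hij.1)
          (Nat.exists_eq_add_of_le hij.2)
        have hi := ih i (by omega) j
        have hNi : (0 : ℝ) < ((N + i : ℕ) : ℝ) := by exact_mod_cast (by omega : 0 < N + i)
        have hpow : (1 : ℝ) ≤ (1 + K) ^ min i T := one_le_pow₀ hL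
        rw [chainSolution_add hm₁, norm_div, Complex.norm_natCast, div_mul_eq_mul_div,
          div_le_iff₀ hNi]
        have hnum : ‖e i j - m₁ * chainSolution m₁ m₂ N e b i j‖ * R ^ (m₁ + i + (m₂ + j)) ≤
            B * (1 + K) ^ min i T * (1 + K) := by
          have hn : ‖e i j - m₁ * chainSolution m₁ m₂ N e b i j‖ ≤
              ‖e i j‖ + m₁ * ‖chainSolution m₁ m₂ N e b i j‖ := by
            refine (norm_sub_le _ _).trans ?_
            rw [norm_mul, Complex.norm_natCast]
          have hP : 0 ≤ R ^ (m₁ + m₂) := by positivity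
          calc _ ≤ (‖e i j‖ + m₁ * ‖chainSolution m₁ m₂ N e b i j‖) *
                R ^ (m₁ + i + (m₂ + j)) := by gcongr
            _ = (‖e i j‖ * R ^ (i + j)) * R ^ (m₁ + m₂) +
                K * (‖chainSolution m₁ m₂ N e b i j‖ * R ^ (i + j)) := by
              rw [hK, show m₁ + i + (m₂ + j) = (i + j) + (m₁ + m₂) by ring, pow_add]
              ring
            _ ≤ |Ce| * R ^ (m₁ + m₂) + K * (B * (1 + K) ^ min i T) := by
              gcongr
              exact (hCe i j).trans (le_abs_self _)
            _ ≤ B * (1 + K) ^ min i T + K * (B * (1 + K) ^ min i T) := by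
              have hle : |Ce| * R ^ (m₁ + m₂) ≤ B := by
                rw [hB]
                linarith [abs_nonneg Cb]
              linarith [hle.trans (le_mul_of_one_le_right hB0 hpow)]
            _ = _ := by ring
        refine hnum.trans ?_
        have hNi1 : (1 : ℝ) ≤ ((N + i : ℕ) : ℝ) := by exact_mod_cast (by omega : 1 ≤ N + i)
        rcases lt_or_ge i T with hiT | hiT
        · rw [mul_assoc, ← pow_succ]
          refine le_trans ?_ (le_mul_of_one_le_right (by positivity) hNi1)
          gcongr
          omega
        · rw [min_eq_right hiT, min_eq_right (by omega : T ≤ m₁ + i)]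
          gcongr
          have h1 : (T : ℝ) + 1 ≤ ((N + i : ℕ) : ℝ) := by exact_mod_cast (by omega)
          linarith
      · rw [chainSolution_of_lt (by omega)]
        refine ((hCb i j).trans (le_abs_self _)).trans ?_
        refine le_trans ?_ (le_mul_of_one_le_right hB0 (one_le_pow₀ hL))
        rw [hB]
        have : 0 ≤ |Ce| * R ^ (m₁ + m₂) := by positivity
        linarith
  refine ⟨B * (1 + K) ^ T, fun i j => (key i j).trans ?_⟩
  gcongr
  omega

lemma rapidDecay_of_support_subset {p q : ℕ} (h : ∀ i j, ¬ (i < p ∧ j < q) → b i j = 0) :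
    RapidDecay b := by
  intro R hR
  refine ⟨∑ x ∈ Finset.range p ×ˢ Finset.range q, ‖b x.1 x.2‖ * R ^ (x.1 + x.2), fun i j => ?_⟩
  by_cases hij : i < p ∧ j < q
  · exact Finset.single_le_sum (f := fun x : ℕ × ℕ => ‖b x.1 x.2‖ * R ^ (x.1 + x.2))
      (fun x _ => by positivity) (show (i, j) ∈ _ by simpa using hij)
  · rw [h i j hij, norm_zero, zero_mul]
    exact Finset.sum_nonneg fun x _ => by positivity

/-- The points `(i, j)` with `m₂ i = m₁ j` and `i < m₁` are the multiples
`t (m₁ / d, m₂ / d)` with `t < d = gcd(m₁, m₂)`. -/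
lemma exists_eq_mul_div_gcd (hm₁ : 0 < m₁) {i j : ℕ} (hij : m₂ * i = m₁ * j) (hi : i < m₁) :
    ∃ t < m₁.gcd m₂, i = t * (m₁ / m₁.gcd m₂) ∧ j = t * (m₂ / m₁.gcd m₂) := by
  have hd : 0 < m₁.gcd m₂ := Nat.gcd_pos_of_pos_left m₂ hm₁
  have hco := Nat.coprime_div_gcd_div_gcd hd
  have h1 : m₁.gcd m₂ * (m₁ / m₁.gcd m₂) = m₁ := Nat.mul_div_cancel' (Nat.gcd_dvd_left _ _)
  have h2 : m₁.gcd m₂ * (m₂ / m₁.gcd m₂) = m₂ := Nat.mul_div_cancel' (Nat.gcd_dvd_right _ _)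
  generalize m₁ / m₁.gcd m₂ = p at hco h1 ⊢
  generalize m₂ / m₁.gcd m₂ = q at hco h2 ⊢
  generalize m₁.gcd m₂ = d at hd h1 h2 ⊢
  subst h1 h2
  have hqp : q * i = p * j := Nat.eq_of_mul_eq_mul_left hd (by simpa only [mul_assoc] using hij)
  have hp : 0 < p := Nat.pos_of_mul_pos_left hm₁
  obtain ⟨t, rfl⟩ : p ∣ i := hco.dvd_of_dvd_mul_left ⟨j, hqp⟩
  refine ⟨t, lt_of_mul_lt_mul_left (by linarith : p * t < p * d) hp.le, mul_comm _ _, ?_⟩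
  exact Nat.eq_of_mul_eq_mul_left hp (by linarith)

lemma mul_div_gcd_diagonal (t : ℕ) :
    m₂ * (t * (m₁ / m₁.gcd m₂)) = m₁ * (t * (m₂ / m₁.gcd m₂)) := by
  have h : m₂ * (m₁ / m₁.gcd m₂) = m₁ * (m₂ / m₁.gcd m₂) := by
    rw [← Nat.mul_div_assoc _ (Nat.gcd_dvd_left _ _), ← Nat.mul_div_assoc _ (Nat.gcd_dvd_right _ _),
      mul_comm]
  rw [mul_left_comm, h, mul_left_comm]

lemma eq_zero_on_diagonal (hm₁ : 0 < m₁) (hN : 0 < N) {w : ℕ → ℕ → ℂ}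
    (hw : ∀ i j, m₂ * i = m₁ * j → ((N + i : ℕ) : ℂ) * w (m₁ + i) (m₂ + j) + m₁ * w i j = 0)
    (h0 : ∀ t < m₁.gcd m₂, w (t * (m₁ / m₁.gcd m₂)) (t * (m₂ / m₁.gcd m₂)) = 0) :
    ∀ i j, m₂ * i = m₁ * j → w i j = 0 := by
  intro i
  induction i using Nat.strong_induction_on with
  | _ i ih =>
    intro j hij
    rcases lt_or_ge i m₁ with hi | hi
    · obtain ⟨t, ht, rfl, rfl⟩ := exists_eq_mul_div_gcd hm₁ hij hi
      exact h0 t ht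
    · have hj : m₂ ≤ j := by
        by_contra! hj
        nlinarith
      obtain ⟨⟨i, rfl⟩, ⟨j, rfl⟩⟩ := And.intro (Nat.exists_eq_add_of_le hi)
        (Nat.exists_eq_add_of_le hj)
      have hij' : m₂ * i = m₁ * j := by linarith
      have h := hw i j hij'
      rw [ih i (by omega) j hij', mul_zero, add_zero] at h
      exact (mul_eq_zero.1 h).resolve_left (by exact_mod_cast (by omega : N + i ≠ 0))

lemma exists_diagonal_solution (hm₁ : 0 < m₁) (hm₂ : 0 < m₂) (hN : 0 < N) (he : RapidDecay e)
    (c : ℕ → ℂ) : ∃ a, RapidDecay a ∧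
      (∀ i j, m₂ * i = m₁ * j →
        ((N + i : ℕ) : ℂ) * a (m₁ + i) (m₂ + j) + m₁ * a i j = e i j) ∧
      (∀ i j, m₂ * i ≠ m₁ * j → a i j = 0) ∧
      ∀ t < m₁.gcd m₂, a (t * (m₁ / m₁.gcd m₂)) (t * (m₂ / m₁.gcd m₂)) = c t := by
  set b : ℕ → ℕ → ℂ := fun i j => if i < m₁ ∧ j < m₂ then c (i / (m₁ / m₁.gcd m₂)) else 0
  have hb : RapidDecay b := rapidDecay_of_support_subset (p := m₁) (q := m₂) fun i j h => if_neg h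
  have ha := rapidDecay_chainSolution (m₂ := m₂) hm₁ hN he hb
  have hgcd : 0 < m₁.gcd m₂ := Nat.gcd_pos_of_pos_left m₂ hm₁
  refine ⟨_, ha.indicator fun i j => m₂ * i = m₁ * j, fun i j hij => ?_, fun i j hij => if_neg hij,
    fun t ht => ?_⟩
  · rw [if_pos hij, if_pos (by linarith), chainSolution_add hm₁]
    have : ((N + i : ℕ) : ℂ) ≠ 0 := by exact_mod_cast (by omega : N + i ≠ 0)
    field_simp
    ring
  · have h1 : t * (m₁ / m₁.gcd m₂) < m₁ := by
      calc _ < m₁.gcd m₂ * (m₁ / m₁.gcd m₂) :=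
            Nat.mul_lt_mul_of_pos_right ht (Nat.div_pos (Nat.gcd_le_left _ hm₁) hgcd)
        _ = m₁ := Nat.mul_div_cancel' (Nat.gcd_dvd_left _ _)
    have h2 : t * (m₂ / m₁.gcd m₂) < m₂ := by
      calc _ < m₁.gcd m₂ * (m₂ / m₁.gcd m₂) :=
            Nat.mul_lt_mul_of_pos_right ht (Nat.div_pos (Nat.gcd_le_right _ hm₂) hgcd)
        _ = m₂ := Nat.mul_div_cancel' (Nat.gcd_dvd_right _ _)
    rw [if_pos (mul_div_gcd_diagonal t), chainSolution_of_lt (Or.inl h1)]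
    simp only [b]
    rw [if_pos ⟨h1, h2⟩, Nat.mul_div_cancel _ (Nat.div_pos (Nat.gcd_le_left _ hm₁) hgcd)]

/-- Division by `m₂ i - m₁ j` off the diagonal preserves rapid decay. -/
lemma RapidDecay.div_diagonal (he : RapidDecay e) (m₁ m₂ : ℕ) :
    RapidDecay fun i j => if m₂ * i = m₁ * j then 0 else e i j / ((m₂ : ℂ) * i - m₁ * j) := by
  refine he.of_norm_le_norm fun i j => ?_
  split_ifs with h
  · simp
  · rw [norm_div]
    refine div_le_self (norm_nonneg _) ?_
    have hz : ((m₂ * i : ℤ) - m₁ * j) ≠ 0 := by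
      rw [sub_ne_zero]
      exact_mod_cast h
    have h1 : (1 : ℝ) ≤ |(((m₂ * i : ℤ) - m₁ * j : ℤ) : ℝ)| := by
      exact_mod_cast Int.one_le_abs hz
    rw [← Complex.norm_intCast] at h1
    exact_mod_cast h1

lemma diagonal_ne_zero {i j : ℕ} (h : m₂ * i ≠ m₁ * j) : (m₂ : ℂ) * i - m₁ * j ≠ 0 := by
  rw [sub_ne_zero]
  exact_mod_cast h

/-- A solution of the homogeneous equations with prescribed initial values. -/
lemma exists_mem_ker (hm₁ : 0 < m₁) (hm₂ : 0 < m₂) (c : ℕ → ℂ) : ∃ a, RapidDecay a ∧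
    (∀ i j : ℕ, (m₁ + i) * a (m₁ + i) (m₂ + j) + m₁ * a i j = 0) ∧
    (∀ i j : ℕ, (m₂ + j) * a (m₁ + i) (m₂ + j) + m₂ * a i j = 0) ∧
      ∀ t < m₁.gcd m₂, a (t * (m₁ / m₁.gcd m₂)) (t * (m₂ / m₁.gcd m₂)) = c t := by
  obtain ⟨a, ha, hdiag, hoff, hc⟩ := exists_diagonal_solution hm₁ hm₂ hm₁ rapidDecay_zero c
  have hm : (m₁ : ℂ) ≠ 0 := by exact_mod_cast hm₁.ne'
  refine ⟨a, ha, fun i j => ?_, fun i j => ?_, hc⟩ <;> by_cases hij : m₂ * i = m₁ * j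
  · simpa using hdiag i j hij
  · rw [hoff i j hij, hoff _ _ fun h => hij (by linarith)]
    simp
  · have h := hdiag i j hij
    have hij' : (m₂ : ℂ) * i = m₁ * j := by exact_mod_cast hij
    push_cast at h
    refine (mul_eq_zero.1 (?_ : (m₁ : ℂ) * _ = 0)).resolve_left hm
    linear_combination m₂ * h - a (m₁ + i) (m₂ + j) * hij'
  · rw [hoff i j hij, hoff _ _ fun h => hij (by linarith)]
    simp

lemma eq_zero_of_mem_ker (hm₁ : 0 < m₁) {a : ℕ → ℕ → ℂ}
    (h1 : ∀ i j : ℕ, (m₁ + i) * a (m₁ + i) (m₂ + j) + m₁ * a i j = 0)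
    (h2 : ∀ i j : ℕ, (m₂ + j) * a (m₁ + i) (m₂ + j) + m₂ * a i j = 0)
    (h0 : ∀ t < m₁.gcd m₂, a (t * (m₁ / m₁.gcd m₂)) (t * (m₂ / m₁.gcd m₂)) = 0) (i j : ℕ) :
    a i j = 0 := by
  by_cases hij : m₂ * i = m₁ * j
  · exact eq_zero_on_diagonal hm₁ hm₁ (fun i j _ => by simpa using h1 i j) h0 i j hij
  · have hm : (m₁ : ℂ) ≠ 0 := by exact_mod_cast hm₁.ne'
    have hs : ((m₂ : ℂ) * i - m₁ * j) * a (m₁ + i) (m₂ + j) = 0 := by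
      linear_combination m₂ * h1 i j - m₁ * h2 i j
    have hs' := (mul_eq_zero.1 hs).resolve_left (diagonal_ne_zero hij)
    have h := h1 i j
    rw [hs', mul_zero, zero_add] at h
    exact (mul_eq_zero.1 h).resolve_left hm

/-- A cocycle with vanishing initial values is a coboundary. -/
lemma exists_primitive (hm₁ : 0 < m₁) (hm₂ : 0 < m₂) {G H : ℕ → ℕ → ℂ} (hG : RapidDecay G)
    (hH : RapidDecay H)
    (hE : ∀ i j : ℕ, (2 * m₂ + j) * G (m₁ + i) (m₂ + j) + m₂ * G i j
      - (2 * m₁ + i) * H (m₁ + i) (m₂ + j) - m₁ * H i j = 0)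
    (h0 : ∀ t < m₁.gcd m₂, m₂ * G (t * (m₁ / m₁.gcd m₂)) (t * (m₂ / m₁.gcd m₂))
      - m₁ * H (t * (m₁ / m₁.gcd m₂)) (t * (m₂ / m₁.gcd m₂)) = 0) :
    ∃ a, RapidDecay a ∧
      (∀ i j : ℕ, G i j = -((m₁ + i) * a (m₁ + i) (m₂ + j) + m₁ * a i j)) ∧
      ∀ i j : ℕ, H i j = -((m₂ + j) * a (m₁ + i) (m₂ + j) + m₂ * a i j) := by
  have hm : (m₁ : ℂ) ≠ 0 := by exact_mod_cast hm₁.ne'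
  have hW := eq_zero_on_diagonal (N := 2 * m₁) hm₁ (by omega)
    (w := fun i j => m₂ * G i j - m₁ * H i j) (fun i j hij => by
      have hij' : (m₂ : ℂ) * i = m₁ * j := by exact_mod_cast hij
      push_cast
      linear_combination m₁ * hE i j + G (m₁ + i) (m₂ + j) * hij') h0
  obtain ⟨a, ha, hdiag, hoff, -⟩ :=
    exists_diagonal_solution hm₁ hm₂ hm₁ (hG.const_mul (-1)) (fun _ => 0)
  have hv := ((hG.affine_mul m₂ 0 1).sub (hH.affine_mul m₁ 1 0)).div_diagonal m₁ m₂
  refine ⟨_, ha.add hv, fun i j => ?_, fun i j => ?_⟩ <;> by_cases hij : m₂ * i = m₁ * j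
  · have hij' : m₂ * (m₁ + i) = m₁ * (m₂ + j) := by linarith
    have h := hdiag i j hij
    simp only [if_pos hij, if_pos hij', add_zero]
    push_cast at h
    linear_combination h
  · have hij' : m₂ * (m₁ + i) ≠ m₁ * (m₂ + j) := fun h => hij (by linarith)
    simp only [if_neg hij, if_neg hij', hoff _ _ hij, hoff _ _ hij', zero_add]
    have hd := diagonal_ne_zero hij
    have hd' : (m₂ : ℂ) * (m₁ + i : ℕ) - m₁ * (m₂ + j : ℕ) = m₂ * i - m₁ * j := by
      push_cast; ring
    rw [hd']
    push_cast
    generalize hδ : (m₂ : ℂ) * i - m₁ * j = δ at hd ⊢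
    field_simp
    linear_combination (m₁ + i) * hE i j - G i j * hδ
  · have hij' : m₂ * (m₁ + i) = m₁ * (m₂ + j) := by linarith
    have h := hdiag i j hij
    have hw := hW i j hij
    have hijc : (m₂ : ℂ) * i = m₁ * j := by exact_mod_cast hij
    simp only [if_pos hij, if_pos hij', add_zero]
    push_cast at h
    refine mul_left_cancel₀ hm ?_
    linear_combination m₂ * h - hw - a (m₁ + i) (m₂ + j) * hijc
  · have hij' : m₂ * (m₁ + i) ≠ m₁ * (m₂ + j) := fun h => hij (by linarith)
    simp only [if_neg hij, if_neg hij', hoff _ _ hij, hoff _ _ hij', zero_add]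
    have hd := diagonal_ne_zero hij
    have hd' : (m₂ : ℂ) * (m₁ + i : ℕ) - m₁ * (m₂ + j : ℕ) = m₂ * i - m₁ * j := by
      push_cast; ring
    rw [hd']
    push_cast
    generalize hδ : (m₂ : ℂ) * i - m₁ * j = δ at hd ⊢
    field_simp
    linear_combination (m₂ + j) * hE i j - H i j * hδ

/-- Solvability of the inhomogeneous cocycle equation, with prescribed initial values. -/
lemma exists_cochain (hm₁ : 0 < m₁) (hm₂ : 0 < m₂) (he : RapidDecay e) (c : ℕ → ℂ) :
    ∃ G H, RapidDecay G ∧ RapidDecay H ∧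
      (∀ i j : ℕ, (2 * m₂ + j) * G (m₁ + i) (m₂ + j) + m₂ * G i j
        - (2 * m₁ + i) * H (m₁ + i) (m₂ + j) - m₁ * H i j = e i j) ∧
      ∀ t < m₁.gcd m₂, m₂ * G (t * (m₁ / m₁.gcd m₂)) (t * (m₂ / m₁.gcd m₂))
        - m₁ * H (t * (m₁ / m₁.gcd m₂)) (t * (m₂ / m₁.gcd m₂)) = c t := by
  have hm : (m₁ : ℂ) ≠ 0 := by exact_mod_cast hm₁.ne'
  have hm' : (m₂ : ℂ) ≠ 0 := by exact_mod_cast hm₂.ne'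
  obtain ⟨w, hw, hdiag, hoff, hc⟩ := exists_diagonal_solution (N := 2 * m₁) hm₁ hm₂ (by omega)
    (he.const_mul m₁) c
  have hk := (he.div_diagonal m₁ m₂).shift m₁ m₂
  set k : ℕ → ℕ → ℂ := fun p q => if m₁ ≤ p ∧ m₂ ≤ q then
    (if m₂ * (p - m₁) = m₁ * (q - m₂) then 0 else
      e (p - m₁) (q - m₂) / ((m₂ : ℂ) * (p - m₁ : ℕ) - m₁ * (q - m₂ : ℕ))) else 0 with hkdef
  have hkadd : ∀ i j, k (m₁ + i) (m₂ + j) =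
      if m₂ * i = m₁ * j then 0 else e i j / ((m₂ : ℂ) * i - m₁ * j) := by
    intro i j
    simp [hkdef]
  refine ⟨_, _, (hw.const_mul (m₂ : ℂ)⁻¹).sub (hk.const_mul m₁), hk.const_mul (-m₂),
    fun i j => ?_, fun t ht => ?_⟩
  · by_cases hij : m₂ * i = m₁ * j
    · have h := hdiag i j hij
      have hijc : (m₂ : ℂ) * i = m₁ * j := by exact_mod_cast hij
      rw [hkadd, if_pos hij]
      push_cast at h
      have hinv : (m₂ : ℂ)⁻¹ * m₂ = 1 := inv_mul_cancel₀ hm'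
      refine mul_left_cancel₀ hm ?_
      linear_combination h + (2 * m₁ + i) * w (m₁ + i) (m₂ + j) * hinv + m₁ * w i j * hinv
        - (m₂ : ℂ)⁻¹ * w (m₁ + i) (m₂ + j) * hijc
    · have hij' : m₂ * (m₁ + i) ≠ m₁ * (m₂ + j) := fun h => hij (by linarith)
      rw [hkadd, if_neg hij, hoff _ _ hij, hoff _ _ hij']
      linear_combination div_mul_cancel₀ (e i j) (diagonal_ne_zero hij)
  · rw [hc t ht |>.symm]
    field_simp
    ring

end Arrays

section Cohomology

variable {m₁ m₂ : ℕ}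

/-- The kernel of `D`, described by Taylor coefficients. -/
noncomputable def kerD (m₁ m₂ : ℕ) : Submodule ℂ (ℂ × ℂ → ℂ) where
  carrier := {u | Differentiable ℂ u ∧
    (∀ i j : ℕ, (m₁ + i) * taylorCoeff (m₁ + i) (m₂ + j) u + m₁ * taylorCoeff i j u = 0) ∧
    ∀ i j : ℕ, (m₂ + j) * taylorCoeff (m₁ + i) (m₂ + j) u + m₂ * taylorCoeff i j u = 0}
  zero_mem' := by
    exact ⟨differentiable_const 0, by simp [taylorCoeff_zero], by simp [taylorCoeff_zero]⟩
  add_mem' := by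
    rintro u v ⟨hu, hu1, hu2⟩ ⟨hv, hv1, hv2⟩
    refine ⟨hu.add hv, fun i j => ?_, fun i j => ?_⟩ <;>
      simp only [hu.taylorCoeff_add hv]
    · linear_combination hu1 i j + hv1 i j
    · linear_combination hu2 i j + hv2 i j
  smul_mem' := by
    rintro c u ⟨hu, hu1, hu2⟩
    refine ⟨hu.const_smul c, fun i j => ?_, fun i j => ?_⟩ <;>
      simp only [hu.taylorCoeff_smul]
    · linear_combination c * hu1 i j
    · linear_combination c * hu2 i j

lemma mem_kerD_iff (hm₁ : 0 < m₁) (hm₂ : 0 < m₂) {u : ℂ × ℂ → ℂ} :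
    u ∈ kerD m₁ m₂ ↔ Differentiable ℂ u ∧
      Dop1 m₁ m₂ u ∈ Pset m₁ (m₂ - 1) ∧ Dop2 m₁ m₂ u ∈ Pset (m₁ - 1) m₂ := by
  refine and_congr_right fun hu => ?_
  simp only [mem_Pset_sub_one_right hm₂, mem_Pset_sub_one_left hm₁, taylorCoeff_Dop1 hm₁ hu,
    taylorCoeff_Dop2 hm₂ hu, neg_eq_zero, (hasTaylorArray_Dop1 hu).differentiable,
    (hasTaylorArray_Dop2 hu).differentiable, true_and]

/-- The initial values of an element of the kernel of `D`. -/
noncomputable def kerDInitial (m₁ m₂ : ℕ) : kerD m₁ m₂ →ₗ[ℂ] (Fin (m₁.gcd m₂) → ℂ) where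
  toFun u t := taylorCoeff (t * (m₁ / m₁.gcd m₂)) (t * (m₂ / m₁.gcd m₂)) u
  map_add' u v := funext fun _ => u.2.1.taylorCoeff_add v.2.1 _ _
  map_smul' c u := funext fun _ => u.2.1.taylorCoeff_smul c _ _

lemma bijective_kerDInitial (hm₁ : 0 < m₁) (hm₂ : 0 < m₂) :
    Function.Bijective (kerDInitial m₁ m₂) := by
  refine ⟨(injective_iff_map_eq_zero _).2 fun u hu => Subtype.ext ?_, fun c => ?_⟩
  · exact u.2.1.eq_zero_of_taylorCoeff <| eq_zero_of_mem_ker hm₁ u.2.2.1 u.2.2.2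
      fun t ht => congrFun hu ⟨t, ht⟩
  · obtain ⟨a, ha, h1, h2, hc⟩ := exists_mem_ker hm₁ hm₂
      fun t => if ht : t < m₁.gcd m₂ then c ⟨t, ht⟩ else 0
    obtain ⟨u, hu, hua⟩ := ha.exists_taylorCoeff_add 0 0
    simp only [zero_add] at hua
    refine ⟨⟨u, hu, by simpa only [hua] using h1, by simpa only [hua] using h2⟩, ?_⟩
    ext t
    simpa [kerDInitial, hua] using hc t t.2

lemma finrank_kerD (hm₁ : 0 < m₁) (hm₂ : 0 < m₂) :
    Module.finrank ℂ (kerD m₁ m₂) = m₁.gcd m₂ := by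
  simpa using (LinearEquiv.ofBijective _ (bijective_kerDInitial hm₁ hm₂)).finrank_eq

/-- The kernel of `E`, described by Taylor coefficients. -/
noncomputable def kerE (m₁ m₂ : ℕ) : Submodule ℂ ((ℂ × ℂ → ℂ) × (ℂ × ℂ → ℂ)) where
  carrier := {ω | Differentiable ℂ ω.1 ∧ Differentiable ℂ ω.2 ∧ ∀ i j : ℕ,
    (2 * m₂ + j) * taylorCoeff (m₁ + 1 + (m₁ + i)) (m₂ + (m₂ + j)) ω.1
      + m₂ * taylorCoeff (m₁ + 1 + i) (m₂ + j) ω.1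
      - (2 * m₁ + i) * taylorCoeff (m₁ + (m₁ + i)) (m₂ + 1 + (m₂ + j)) ω.2
      - m₁ * taylorCoeff (m₁ + i) (m₂ + 1 + j) ω.2 = 0}
  zero_mem' := by
    exact ⟨differentiable_const 0, differentiable_const 0, by simp [taylorCoeff_zero]⟩
  add_mem' := by
    rintro ω η ⟨hg, hh, hω⟩ ⟨hg', hh', hη⟩
    refine ⟨hg.add hg', hh.add hh', fun i j => ?_⟩
    simp only [Prod.fst_add, Prod.snd_add, hg.taylorCoeff_add hg', hh.taylorCoeff_add hh']
    linear_combination hω i j + hη i j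
  smul_mem' := by
    rintro c ω ⟨hg, hh, hω⟩
    refine ⟨hg.const_smul c, hh.const_smul c, fun i j => ?_⟩
    simp only [Prod.smul_fst, Prod.smul_snd, hg.taylorCoeff_smul, hh.taylorCoeff_smul]
    linear_combination c * hω i j

lemma mem_kerE_iff (hm₁ : 0 < m₁) (hm₂ : 0 < m₂) {ω : (ℂ × ℂ → ℂ) × (ℂ × ℂ → ℂ)} :
    ω ∈ kerE m₁ m₂ ↔ Differentiable ℂ ω.1 ∧ Differentiable ℂ ω.2 ∧
      Eop m₁ m₂ ω.1 ω.2 ∈ Pset (2 * m₁) (2 * m₂) := by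
  refine and_congr_right fun hg => and_congr_right fun hh => ?_
  simp only [mem_Pset_iff, taylorCoeff_Eop hm₁ hm₂ hg hh, (hasTaylorArray_Eop hg hh).differentiable,
    true_and]

/-- The preimage of the image of `D` in the pairs of entire functions, described by Taylor
coefficients. -/
noncomputable def imD (m₁ m₂ : ℕ) : Submodule ℂ ((ℂ × ℂ → ℂ) × (ℂ × ℂ → ℂ)) where
  carrier := {ω | Differentiable ℂ ω.1 ∧ Differentiable ℂ ω.2 ∧ ∃ u : ℂ × ℂ → ℂ,
    Differentiable ℂ u ∧
    (∀ i j : ℕ, taylorCoeff (m₁ + 1 + i) (m₂ + j) ω.1 =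
      -((m₁ + i) * taylorCoeff (m₁ + i) (m₂ + j) u + m₁ * taylorCoeff i j u)) ∧
    ∀ i j : ℕ, taylorCoeff (m₁ + i) (m₂ + 1 + j) ω.2 =
      -((m₂ + j) * taylorCoeff (m₁ + i) (m₂ + j) u + m₂ * taylorCoeff i j u)}
  zero_mem' := by
    exact ⟨differentiable_const 0, differentiable_const 0, 0, differentiable_const 0,
      by simp [taylorCoeff_zero], by simp [taylorCoeff_zero]⟩
  add_mem' := by
    rintro ω η ⟨hg, hh, u, hu, h1, h2⟩ ⟨hg', hh', v, hv, h1', h2'⟩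
    refine ⟨hg.add hg', hh.add hh', u + v, hu.add hv, fun i j => ?_, fun i j => ?_⟩ <;>
      simp only [Prod.fst_add, Prod.snd_add, hg.taylorCoeff_add hg', hh.taylorCoeff_add hh',
        hu.taylorCoeff_add hv]
    · linear_combination h1 i j + h1' i j
    · linear_combination h2 i j + h2' i j
  smul_mem' := by
    rintro c ω ⟨hg, hh, u, hu, h1, h2⟩
    refine ⟨hg.const_smul c, hh.const_smul c, c • u, hu.const_smul c, fun i j => ?_,
      fun i j => ?_⟩ <;>
      simp only [Prod.smul_fst, Prod.smul_snd, hg.taylorCoeff_smul, hh.taylorCoeff_smul,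
        hu.taylorCoeff_smul]
    · linear_combination c * h1 i j
    · linear_combination c * h2 i j

lemma mem_imD_iff (hm₁ : 0 < m₁) (hm₂ : 0 < m₂) {ω : (ℂ × ℂ → ℂ) × (ℂ × ℂ → ℂ)} :
    ω ∈ imD m₁ m₂ ↔ Differentiable ℂ ω.1 ∧ Differentiable ℂ ω.2 ∧
      ∃ u : ℂ × ℂ → ℂ, Differentiable ℂ u ∧ ω.1 - Dop1 m₁ m₂ u ∈ Pset m₁ (m₂ - 1) ∧
        ω.2 - Dop2 m₁ m₂ u ∈ Pset (m₁ - 1) m₂ := by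
  refine and_congr_right fun hg => and_congr_right fun hh => exists_congr fun u =>
    and_congr_right fun hu => ?_
  have h1 := (hasTaylorArray_Dop1 (m₁ := m₁) (m₂ := m₂) hu).differentiable
  have h2 := (hasTaylorArray_Dop2 (m₁ := m₁) (m₂ := m₂) hu).differentiable
  simp only [mem_Pset_sub_one_right hm₂, mem_Pset_sub_one_left hm₁, hg.taylorCoeff_sub h1,
    hh.taylorCoeff_sub h2, taylorCoeff_Dop1 hm₁ hu, taylorCoeff_Dop2 hm₂ hu, sub_eq_zero,
    hg.sub h1, hh.sub h2, true_and]

lemma imD_le_kerE (m₁ m₂ : ℕ) : imD m₁ m₂ ≤ kerE m₁ m₂ := by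
  rintro ω ⟨hg, hh, u, -, h1, h2⟩
  refine ⟨hg, hh, fun i j => ?_⟩
  rw [h1, h1, h2, h2]
  push_cast
  ring

/-- The initial values of an element of the kernel of `E`, which determine its cohomology class. -/
noncomputable def kerEInitial (m₁ m₂ : ℕ) : kerE m₁ m₂ →ₗ[ℂ] (Fin (m₁.gcd m₂) → ℂ) where
  toFun ω t :=
    m₂ * taylorCoeff (m₁ + 1 + t * (m₁ / m₁.gcd m₂)) (m₂ + t * (m₂ / m₁.gcd m₂)) ω.1.1
      - m₁ * taylorCoeff (m₁ + t * (m₁ / m₁.gcd m₂)) (m₂ + 1 + t * (m₂ / m₁.gcd m₂)) ω.1.2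
  map_add' ω η := by
    ext t
    simp only [Submodule.coe_add, Prod.fst_add, Prod.snd_add, ω.2.1.taylorCoeff_add η.2.1,
      ω.2.2.1.taylorCoeff_add η.2.2.1, Pi.add_apply]
    ring
  map_smul' c ω := by
    ext t
    simp only [Submodule.coe_smul, Prod.smul_fst, Prod.smul_snd, ω.2.1.taylorCoeff_smul,
      ω.2.2.1.taylorCoeff_smul, Pi.smul_apply, smul_eq_mul, RingHom.id_apply]
    ring

lemma surjective_kerEInitial (hm₁ : 0 < m₁) (hm₂ : 0 < m₂) :
    Function.Surjective (kerEInitial m₁ m₂) := fun c => by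
  obtain ⟨G, H, hG, hH, hE, hc⟩ := exists_cochain hm₁ hm₂ rapidDecay_zero
    fun t => if ht : t < m₁.gcd m₂ then c ⟨t, ht⟩ else 0
  obtain ⟨g, hg, hgG⟩ := hG.exists_taylorCoeff_add (m₁ + 1) m₂
  obtain ⟨h, hh, hhH⟩ := hH.exists_taylorCoeff_add m₁ (m₂ + 1)
  refine ⟨⟨(g, h), hg, hh, by simpa only [hgG, hhH] using hE⟩, ?_⟩
  ext t
  simpa [kerEInitial, hgG, hhH] using hc t t.2

lemma ker_kerEInitial (hm₁ : 0 < m₁) (hm₂ : 0 < m₂) :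
    LinearMap.ker (kerEInitial m₁ m₂) = (imD m₁ m₂).comap (kerE m₁ m₂).subtype := by
  ext ⟨ω, hg, hh, hE⟩
  rw [LinearMap.mem_ker, Submodule.mem_comap, Submodule.subtype_apply]
  constructor
  · intro h0
    obtain ⟨a, ha, h1, h2⟩ := exists_primitive hm₁ hm₂ (rapidDecay_taylorCoeff_add hg (m₁ + 1) m₂)
      (rapidDecay_taylorCoeff_add hh m₁ (m₂ + 1)) hE fun t ht => congrFun h0 ⟨t, ht⟩
    obtain ⟨u, hu, hua⟩ := ha.exists_taylorCoeff_add 0 0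
    simp only [zero_add] at hua
    exact ⟨hg, hh, u, hu, by simpa only [hua] using h1, by simpa only [hua] using h2⟩
  · rintro ⟨-, -, u, -, h1, h2⟩
    ext t
    have ht : (m₂ : ℂ) * ((t * (m₁ / m₁.gcd m₂) : ℕ) : ℂ) =
        m₁ * ((t * (m₂ / m₁.gcd m₂) : ℕ) : ℂ) := by
      exact_mod_cast mul_div_gcd_diagonal (m₁ := m₁) (m₂ := m₂) t
    change (m₂ : ℂ) * taylorCoeff _ _ ω.1 - m₁ * taylorCoeff _ _ ω.2 = 0
    rw [h1, h2]
    linear_combination -taylorCoeff (m₁ + t * (m₁ / m₁.gcd m₂)) (m₂ + t * (m₂ / m₁.gcd m₂)) u * ht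

lemma finrank_kerE_quotient_imD (hm₁ : 0 < m₁) (hm₂ : 0 < m₂) :
    Module.finrank ℂ (kerE m₁ m₂ ⧸ (imD m₁ m₂).comap (kerE m₁ m₂).subtype) = m₁.gcd m₂ := by
  rw [← ker_kerEInitial hm₁ hm₂,
    ((kerEInitial m₁ m₂).quotKerEquivOfSurjective (surjective_kerEInitial hm₁ hm₂)).finrank_eq]
  simp

lemma exists_sub_Eop_mem_Pset (hm₁ : 0 < m₁) (hm₂ : 0 < m₂) {f : ℂ × ℂ → ℂ}
    (hf : Differentiable ℂ f) : ∃ g h : ℂ × ℂ → ℂ, Differentiable ℂ g ∧ Differentiable ℂ h ∧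
      f - Eop m₁ m₂ g h ∈ Pset (2 * m₁) (2 * m₂) := by
  obtain ⟨G, H, hG, hH, hE, -⟩ := exists_cochain hm₁ hm₂
    (rapidDecay_taylorCoeff_add hf (2 * m₁ + 1) (2 * m₂ + 1)) fun _ => 0
  obtain ⟨g, hg, hgG⟩ := hG.exists_taylorCoeff_add (m₁ + 1) m₂
  obtain ⟨h, hh, hhH⟩ := hH.exists_taylorCoeff_add m₁ (m₂ + 1)
  have hd := (hasTaylorArray_Eop (m₁ := m₁) (m₂ := m₂) hg hh).differentiable
  refine ⟨g, h, hg, hh, mem_Pset_iff.2 ⟨hf.sub hd, fun i j => ?_⟩⟩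
  rw [hf.taylorCoeff_sub hd, taylorCoeff_Eop hm₁ hm₂ hg hh, hgG, hgG, hhH, hhH, hE, sub_self]

lemma Eop_mem_Pset (hm₁ : 0 < m₁) (hm₂ : 0 < m₂) {g h : ℂ × ℂ → ℂ}
    (hg : g ∈ Pset m₁ (m₂ - 1)) (hh : h ∈ Pset (m₁ - 1) m₂) :
    Eop m₁ m₂ g h ∈ Pset (2 * m₁) (2 * m₂) := by
  rw [mem_Pset_sub_one_right hm₂] at hg
  rw [mem_Pset_sub_one_left hm₁] at hh
  refine mem_Pset_iff.2 ⟨(hasTaylorArray_Eop hg.1 hh.1).differentiable, fun i j => ?_⟩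
  simp [taylorCoeff_Eop hm₁ hm₂ hg.1 hh.1, hg.2, hh.2]

lemma Eop_Dop_mem_Pset (hm₁ : 0 < m₁) (hm₂ : 0 < m₂) {u : ℂ × ℂ → ℂ}
    (hu : Differentiable ℂ u) :
    Eop m₁ m₂ (Dop1 m₁ m₂ u) (Dop2 m₁ m₂ u) ∈ Pset (2 * m₁) (2 * m₂) :=
  ((mem_kerE_iff hm₁ hm₂ (ω := (Dop1 m₁ m₂ u, Dop2 m₁ m₂ u))).1 <| imD_le_kerE m₁ m₂
    ⟨(hasTaylorArray_Dop1 hu).differentiable, (hasTaylorArray_Dop2 hu).differentiable, u, hu,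
      taylorCoeff_Dop1 hm₁ hu, taylorCoeff_Dop2 hm₂ hu⟩).2.2

end Cohomology

/-- The complex (equ:Hol) of Step 2 of the proof of Theorem 4.5 of the paper:
`𝒪(ℂ²) →^{D} 𝒪(ℂ²)/P_{m₁,m₂−1} ⊕ 𝒪(ℂ²)/P_{m₁−1,m₂} →^{E} 𝒪(ℂ²)/P_{2m₁,2m₂}`
is a well-defined complex with `dim ker D = d`, `dim (ker E / im D) = d`
(`d = gcd(m₁,m₂)`), and `E` surjective.  All statements about the maps induced on
the quotients are expressed via representatives. -/
theorem local_deRham_complex_Hol (m₁ m₂ : ℕ) (hm₁ : 0 < m₁) (hm₂ : 0 < m₂) :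
    -- (i) E is well defined on the quotients and E ∘ D = 0
    (∀ g h : ℂ × ℂ → ℂ, g ∈ Pset m₁ (m₂ - 1) → h ∈ Pset (m₁ - 1) m₂ →
      Eop m₁ m₂ g h ∈ Pset (2 * m₁) (2 * m₂)) ∧
    (∀ u : ℂ × ℂ → ℂ, Differentiable ℂ u →
      Eop m₁ m₂ (Dop1 m₁ m₂ u) (Dop2 m₁ m₂ u) ∈ Pset (2 * m₁) (2 * m₂)) ∧
    -- (ii) dim ker D = gcd(m₁, m₂)
    (∃ KD : Submodule ℂ (ℂ × ℂ → ℂ),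
      (∀ u : ℂ × ℂ → ℂ, u ∈ KD ↔ Differentiable ℂ u ∧
        Dop1 m₁ m₂ u ∈ Pset m₁ (m₂ - 1) ∧ Dop2 m₁ m₂ u ∈ Pset (m₁ - 1) m₂) ∧
      Module.finrank ℂ KD = Nat.gcd m₁ m₂) ∧
    -- (iii) dim (ker E / im D) = gcd(m₁, m₂)
    (∃ KE ID : Submodule ℂ ((ℂ × ℂ → ℂ) × (ℂ × ℂ → ℂ)),
      (∀ ω : (ℂ × ℂ → ℂ) × (ℂ × ℂ → ℂ), ω ∈ KE ↔
        Differentiable ℂ ω.1 ∧ Differentiable ℂ ω.2 ∧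
          Eop m₁ m₂ ω.1 ω.2 ∈ Pset (2 * m₁) (2 * m₂)) ∧
      (∀ ω : (ℂ × ℂ → ℂ) × (ℂ × ℂ → ℂ), ω ∈ ID ↔
        Differentiable ℂ ω.1 ∧ Differentiable ℂ ω.2 ∧
          ∃ u : ℂ × ℂ → ℂ, Differentiable ℂ u ∧
            ω.1 - Dop1 m₁ m₂ u ∈ Pset m₁ (m₂ - 1) ∧
            ω.2 - Dop2 m₁ m₂ u ∈ Pset (m₁ - 1) m₂) ∧
      ID ≤ KE ∧
      Module.finrank ℂ (KE ⧸ ID.comap KE.subtype) = Nat.gcd m₁ m₂) ∧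
    -- (iv) E is surjective
    (∀ f : ℂ × ℂ → ℂ, Differentiable ℂ f →
      ∃ g h : ℂ × ℂ → ℂ, Differentiable ℂ g ∧ Differentiable ℂ h ∧
        f - Eop m₁ m₂ g h ∈ Pset (2 * m₁) (2 * m₂)) := by
  exact ⟨fun _ _ hg hh => Eop_mem_Pset hm₁ hm₂ hg hh, fun _ hu => Eop_Dop_mem_Pset hm₁ hm₂ hu,
    ⟨kerD m₁ m₂, fun _ => mem_kerD_iff hm₁ hm₂, finrank_kerD hm₁ hm₂⟩,
    ⟨kerE m₁ m₂, imD m₁ m₂, fun _ => mem_kerE_iff hm₁ hm₂, fun _ => mem_imD_iff hm₁ hm₂,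
      imD_le_kerE m₁ m₂, finrank_kerE_quotient_imD hm₁ hm₂⟩,
    fun _ hf => exists_sub_Eop_mem_Pset hm₁ hm₂ hf⟩
end

section
/- Let m₁, m₂ be positive integers. Let ℒ be the ℂ-vector space of all families f : ℤ × ℤ → ℂ for which there exists M ∈ ℕ with f(k,l) = 0 whenever k < −M and l < −M, and for integers M, N let K_{M,N} := {f ∈ ℒ : f(k,l) = 0 whenever k < M and l < N}. Define Φ : ℒ → ℒ ⊕ ℒ by Φ(f)(k,l) := ((k+1)·f(k+1,l) − m₁·f(k+m₁+1, l+m₂), (l+1)·f(k,l+1) − m₂·f(k+m₁, l+m₂+1)) and Ψ : ℒ ⊕ ℒ → ℒ by Ψ(g,h)(k,l) := (k+1)·h(k+1,l) − (l+1)·g(k,l+1) + m₂·g(k+m₁, l+m₂+1) − m₁·h(k+m₁+1, l+m₂). Then Φ maps K_{1,1} into K_{−m₁,−m₂+1} ⊕ K_{−m₁+1,−m₂}, Ψ maps K_{−m₁,−m₂+1} ⊕ K_{−m₁+1,−m₂} into K_{−2m₁,−2m₂}, and the induced sequence of quotient spaces ℒ/K_{1,1} → (ℒ/K_{−m₁,−m₂+1})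 ⊕ (ℒ/K_{−m₁+1,−m₂}) → ℒ/K_{−2m₁,−2m₂} → 0 is exact and its first map is injective (i.e. the induced complex is acyclic). -/
/-- `ℒ`: families `f : ℤ × ℤ → ℂ` vanishing in the region where both indices are
sufficiently negative (coefficient arrays of sections of `L₁ + L₂`). -/
def Lset : Set (ℤ × ℤ → ℂ) :=
  {f | ∃ M : ℕ, ∀ k l : ℤ, k < -(M : ℤ) → l < -(M : ℤ) → f (k, l) = 0}

/-- `K_{M,N}`: elements of `ℒ` vanishing at all `(k,l)` with `k < M` and `l < N`. -/
def Kset (M N : ℤ) : Set (ℤ × ℤ → ℂ) :=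
  {f | f ∈ Lset ∧ ∀ k l : ℤ, k < M → l < N → f (k, l) = 0}

/-- First component of the coefficientwise operator `Φ`. -/
noncomputable def Φ1 (m₁ m₂ : ℕ) (f : ℤ × ℤ → ℂ) : ℤ × ℤ → ℂ :=
  fun p => ((p.1 + 1 : ℤ) : ℂ) * f (p.1 + 1, p.2)
    - (m₁ : ℂ) * f (p.1 + (m₁ : ℤ) + 1, p.2 + (m₂ : ℤ))

/-- Second component of the coefficientwise operator `Φ`. -/
noncomputable def Φ2 (m₁ m₂ : ℕ) (f : ℤ × ℤ → ℂ) : ℤ × ℤ → ℂ :=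
  fun p => ((p.2 + 1 : ℤ) : ℂ) * f (p.1, p.2 + 1)
    - (m₂ : ℂ) * f (p.1 + (m₁ : ℤ), p.2 + (m₂ : ℤ) + 1)

/-- The coefficientwise operator `Ψ`. -/
noncomputable def Ψop (m₁ m₂ : ℕ) (g h : ℤ × ℤ → ℂ) : ℤ × ℤ → ℂ :=
  fun p => ((p.1 + 1 : ℤ) : ℂ) * h (p.1 + 1, p.2)
    - ((p.2 + 1 : ℤ) : ℂ) * g (p.1, p.2 + 1)
    + (m₂ : ℂ) * g (p.1 + (m₁ : ℤ), p.2 + (m₂ : ℤ) + 1)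
    - (m₁ : ℂ) * h (p.1 + (m₁ : ℤ) + 1, p.2 + (m₂ : ℤ))

theorem Φ1_mem_Lset (m₁ m₂ : ℕ) {f : ℤ × ℤ → ℂ} (hf : f ∈ Lset) : Φ1 m₁ m₂ f ∈ Lset := by
  obtain ⟨M, hM⟩ := hf
  refine ⟨M + m₁ + m₂ + 1, fun k l hk hl => ?_⟩
  push_cast at hk hl
  simp only [Φ1]
  rw [hM (k + 1) l (by lia) (by lia), hM (k + m₁ + 1) (l + m₂) (by lia) (by lia)]
  ring

theorem Φ2_mem_Lset (m₁ m₂ : ℕ) {f : ℤ × ℤ → ℂ} (hf : f ∈ Lset) : Φ2 m₁ m₂ f ∈ Lset := by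
  obtain ⟨M, hM⟩ := hf
  refine ⟨M + m₁ + m₂ + 1, fun k l hk hl => ?_⟩
  push_cast at hk hl
  simp only [Φ2]
  rw [hM k (l + 1) (by lia) (by lia), hM (k + m₁) (l + m₂ + 1) (by lia) (by lia)]
  ring

theorem sub_mem_Lset {f g : ℤ × ℤ → ℂ} (hf : f ∈ Lset) (hg : g ∈ Lset) : f - g ∈ Lset := by
  obtain ⟨M, hM⟩ := hf
  obtain ⟨N, hN⟩ := hg
  refine ⟨M + N, fun k l hk hl => ?_⟩
  push_cast at hk hl
  rw [Pi.sub_apply, hM k l (by lia) (by lia), hN k l (by lia) (by lia), sub_zero]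

theorem zero_mem_Kset (M N : ℤ) : (0 : ℤ × ℤ → ℂ) ∈ Kset M N :=
  ⟨⟨0, fun _ _ _ _ => rfl⟩, fun _ _ _ _ => rfl⟩

theorem Ψop_eq_sub (m₁ m₂ : ℕ) (g h : ℤ × ℤ → ℂ) :
    Ψop m₁ m₂ g h = Φ1 m₁ m₂ h - Φ2 m₁ m₂ g := by
  funext p
  simp only [Ψop, Φ1, Φ2, Pi.sub_apply]
  ring

theorem Φ1_sub (m₁ m₂ : ℕ) (f g : ℤ × ℤ → ℂ) :
    Φ1 m₁ m₂ (f - g) = Φ1 m₁ m₂ f - Φ1 m₁ m₂ g := by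
  funext p
  simp only [Φ1, Pi.sub_apply]
  ring

/-- The two components of `Φ` commute: the connection is integrable. -/
theorem Φ1_Φ2_comm (m₁ m₂ : ℕ) (f : ℤ × ℤ → ℂ) :
    Φ1 m₁ m₂ (Φ2 m₁ m₂ f) = Φ2 m₁ m₂ (Φ1 m₁ m₂ f) := by
  funext ⟨k, l⟩
  simp only [Φ1, Φ2]
  have e₁ : k + 1 + (m₁ : ℤ) = k + m₁ + 1 := by ring
  have e₂ : l + 1 + (m₂ : ℤ) = l + m₂ + 1 := by ring
  have e₃ : k + (m₁ : ℤ) + 1 + m₁ = k + m₁ + m₁ + 1 := by ring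
  have e₄ : l + (m₂ : ℤ) + 1 + m₂ = l + m₂ + m₂ + 1 := by ring
  rw [e₁, e₂, e₃, e₄]
  push_cast
  ring

/-- The equation `Φ1 f = 0` propagates the vanishing of `f` from the region where both indices
are very negative. -/
theorem eq_zero_of_Φ1_eq_zero {m₁ m₂ : ℕ} (hm₁ : 0 < m₁) (hm₂ : 0 < m₂) {f : ℤ × ℤ → ℂ}
    (hf : f ∈ Lset) {A B : ℤ}
    (h : ∀ k l : ℤ, k < A - m₁ → l < B - m₂ → Φ1 m₁ m₂ f (k, l) = 0)
    (k l : ℤ) (hk : k < A + 1) (hl : l < B) : f (k, l) = 0 := by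
  obtain ⟨M, hM⟩ := hf
  have key : ∀ n : ℕ, ∀ k l : ℤ, k < -(M : ℤ) + n → l < -(M : ℤ) + n → k < A + 1 → l < B →
      f (k, l) = 0 := by
    intro n
    induction n with
    | zero => exact fun k l hk hl _ _ => hM k l (by simpa using hk) (by simpa using hl)
    | succ n ih =>
      intro k l hk hl hkA hlB
      push_cast at hk hl
      have h₀ := h (k - m₁ - 1) (l - m₂) (by lia) (by lia)
      simp only [Φ1] at h₀
      have e : k - (m₁ : ℤ) - 1 + m₁ + 1 = k := by ring
      rw [ih (k - m₁ - 1 + 1) (l - m₂) (by lia) (by lia) (by lia) (by lia), e, sub_add_cancel l,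
        mul_zero, zero_sub, neg_eq_zero] at h₀
      exact (mul_eq_zero.mp h₀).resolve_left (by exact_mod_cast hm₁.ne')
  exact key (M + k.natAbs + l.natAbs + 1) k l (by lia) (by lia) hk hl

/-- The recursive solution `f` of `Φ1 f = g` that vanishes where both indices are `< -M`. -/
noncomputable def Φ1Solution {m₁ m₂ : ℕ} (hm₁ : 0 < m₁) (hm₂ : 0 < m₂) (M : ℕ)
    (g : ℤ × ℤ → ℂ) (a b : ℤ) : ℂ :=
  if a < -(M : ℤ) ∧ b < -(M : ℤ) then 0
  else (((a - m₁ : ℤ) : ℂ) * Φ1Solution hm₁ hm₂ M g (a - m₁) (b - m₂)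
    - g (a - m₁ - 1, b - m₂)) / m₁
termination_by (max a b + M + 1).toNat
decreasing_by lia

theorem Φ1_surjOn_Lset {m₁ m₂ : ℕ} (hm₁ : 0 < m₁) (hm₂ : 0 < m₂) {g : ℤ × ℤ → ℂ}
    (hg : g ∈ Lset) : ∃ f ∈ Lset, Φ1 m₁ m₂ f = g := by
  obtain ⟨M, hM⟩ := hg
  have hzero : ∀ a b : ℤ, a < -(M : ℤ) → b < -(M : ℤ) → Φ1Solution hm₁ hm₂ M g a b = 0 := by
    intro a b ha hb
    rw [Φ1Solution, if_pos ⟨ha, hb⟩]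
  refine ⟨fun p => Φ1Solution hm₁ hm₂ M g p.1 p.2, ⟨M, hzero⟩, ?_⟩
  funext ⟨k, l⟩
  simp only [Φ1]
  by_cases hkl : k + (m₁ : ℤ) + 1 < -(M : ℤ) ∧ l + (m₂ : ℤ) < -(M : ℤ)
  · rw [hzero _ _ hkl.1 hkl.2, hzero (k + 1) l (by lia) (by lia), hM k l (by lia) (by lia)]
    ring
  · have e₁ : k + (m₁ : ℤ) + 1 - m₁ = k + 1 := by ring
    have hm : (m₁ : ℂ) ≠ 0 := by exact_mod_cast hm₁.ne'
    rw [Φ1Solution.eq_def hm₁ hm₂ M g (k + m₁ + 1), if_neg hkl, e₁, add_sub_cancel_right,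
      add_sub_cancel_right, mul_div_cancel₀ _ hm, sub_sub_cancel]

/-- Lemma 4.6 (lem:k′) of the paper, coefficientwise: the induced complex
`ℒ/K_{1,1} → (ℒ/K_{−m₁,−m₂+1}) ⊕ (ℒ/K_{−m₁+1,−m₂}) → ℒ/K_{−2m₁,−2m₂} → 0`
is acyclic: the first map is injective, the sequence is exact in the middle, and
the second map is surjective. -/
theorem K_prime_complex_acyclic (m₁ m₂ : ℕ) (hm₁ : 0 < m₁) (hm₂ : 0 < m₂) :
    -- Φ maps ℒ into ℒ ⊕ ℒ and K_{1,1} into K_{−m₁,−m₂+1} ⊕ K_{−m₁+1,−m₂}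
    (∀ f ∈ Lset, Φ1 m₁ m₂ f ∈ Lset ∧ Φ2 m₁ m₂ f ∈ Lset) ∧
    (∀ f ∈ Kset 1 1,
      Φ1 m₁ m₂ f ∈ Kset (-(m₁ : ℤ)) (-(m₂ : ℤ) + 1) ∧
      Φ2 m₁ m₂ f ∈ Kset (-(m₁ : ℤ) + 1) (-(m₂ : ℤ))) ∧
    -- Ψ maps ℒ ⊕ ℒ into ℒ and K ⊕ K into K_{−2m₁,−2m₂}
    (∀ g ∈ Lset, ∀ h ∈ Lset, Ψop m₁ m₂ g h ∈ Lset) ∧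
    (∀ g ∈ Kset (-(m₁ : ℤ)) (-(m₂ : ℤ) + 1), ∀ h ∈ Kset (-(m₁ : ℤ) + 1) (-(m₂ : ℤ)),
      Ψop m₁ m₂ g h ∈ Kset (-(2 * m₁ : ℤ)) (-(2 * m₂ : ℤ))) ∧
    -- the induced sequence of quotients is a complex
    (∀ f ∈ Lset, Ψop m₁ m₂ (Φ1 m₁ m₂ f) (Φ2 m₁ m₂ f) ∈ Kset (-(2 * m₁ : ℤ)) (-(2 * m₂ : ℤ))) ∧
    -- the induced first map is injective
    (∀ f ∈ Lset, Φ1 m₁ m₂ f ∈ Kset (-(m₁ : ℤ)) (-(m₂ : ℤ) + 1) →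
      Φ2 m₁ m₂ f ∈ Kset (-(m₁ : ℤ) + 1) (-(m₂ : ℤ)) → f ∈ Kset 1 1) ∧
    -- exactness in the middle
    (∀ g ∈ Lset, ∀ h ∈ Lset,
      Ψop m₁ m₂ g h ∈ Kset (-(2 * m₁ : ℤ)) (-(2 * m₂ : ℤ)) →
      ∃ f ∈ Lset, Φ1 m₁ m₂ f - g ∈ Kset (-(m₁ : ℤ)) (-(m₂ : ℤ) + 1) ∧
        Φ2 m₁ m₂ f - h ∈ Kset (-(m₁ : ℤ) + 1) (-(m₂ : ℤ))) ∧
    -- surjectivity of the induced second map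
    (∀ u ∈ Lset, ∃ g ∈ Lset, ∃ h ∈ Lset,
      Ψop m₁ m₂ g h - u ∈ Kset (-(2 * m₁ : ℤ)) (-(2 * m₂ : ℤ))) := by
  have hΨL : ∀ g ∈ Lset, ∀ h ∈ Lset, Ψop m₁ m₂ g h ∈ Lset := fun g hg h hh => by
    rw [Ψop_eq_sub]
    exact sub_mem_Lset (Φ1_mem_Lset m₁ m₂ hh) (Φ2_mem_Lset m₁ m₂ hg)
  refine ⟨fun f hf => ⟨Φ1_mem_Lset m₁ m₂ hf, Φ2_mem_Lset m₁ m₂ hf⟩, ?_, hΨL, ?_, ?_, ?_, ?_, ?_⟩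
  · rintro f ⟨hf, h₀⟩
    refine ⟨⟨Φ1_mem_Lset m₁ m₂ hf, fun k l hk hl => ?_⟩,
      ⟨Φ2_mem_Lset m₁ m₂ hf, fun k l hk hl => ?_⟩⟩
    · simp only [Φ1]
      rw [h₀ (k + 1) l (by lia) (by lia), h₀ (k + m₁ + 1) (l + m₂) (by lia) (by lia)]
      ring
    · simp only [Φ2]
      rw [h₀ k (l + 1) (by lia) (by lia), h₀ (k + m₁) (l + m₂ + 1) (by lia) (by lia)]
      ring
  · rintro g ⟨hg, hg₀⟩ h ⟨hh, hh₀⟩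
    refine ⟨hΨL g hg h hh, fun k l hk hl => ?_⟩
    simp only [Ψop]
    rw [hh₀ (k + 1) l (by lia) (by lia), hg₀ k (l + 1) (by lia) (by lia),
      hg₀ (k + m₁) (l + m₂ + 1) (by lia) (by lia), hh₀ (k + m₁ + 1) (l + m₂) (by lia) (by lia)]
    ring
  · intro f _
    rw [Ψop_eq_sub, Φ1_Φ2_comm, sub_self]
    exact zero_mem_Kset _ _
  · rintro f hf ⟨-, h₁⟩ -
    exact ⟨hf, fun k l hk hl => eq_zero_of_Φ1_eq_zero hm₁ hm₂ hf (A := 0) (B := 1)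
      (fun k l hk hl => h₁ k l (by lia) (by lia)) k l (by lia) hl⟩
  · rintro g hg h hh ⟨-, h₀⟩
    obtain ⟨f, hf, rfl⟩ := Φ1_surjOn_Lset hm₁ hm₂ hg
    have hd := sub_mem_Lset (Φ2_mem_Lset m₁ m₂ hf) hh
    refine ⟨f, hf, by rw [sub_self]; exact zero_mem_Kset _ _, hd, fun k l hk hl => ?_⟩
    refine eq_zero_of_Φ1_eq_zero hm₁ hm₂ hd (A := -m₁) (B := -m₂) (fun k l hk hl => ?_) k l hk hl
    have h₁ := h₀ k l (by lia) (by lia)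
    rw [Ψop_eq_sub, ← Φ1_Φ2_comm, ← neg_sub, Pi.neg_apply, neg_eq_zero] at h₁
    rw [Φ1_sub, h₁]
  · intro u hu
    obtain ⟨h, hh, rfl⟩ := Φ1_surjOn_Lset hm₁ hm₂ hu
    refine ⟨0, (zero_mem_Kset 0 0).1, h, hh, ?_⟩
    have h₀ : Φ2 m₁ m₂ 0 = 0 := by
      funext p
      simp [Φ2]
    rw [Ψop_eq_sub, h₀, sub_zero, sub_self]
    exact zero_mem_Kset _ _
end
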